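/- arXiv:2403.08983 — 8 statements merged into one kernel-verified Lean document; each statement's English description precedes it below -/
import Mathlib

section
/- There is an absolute constant c ≥ 1 with the following property (existence of edge sample sets for sparse cuts). Let G be a connected finite simple graph on n ≥ 1 vertices, let ε ∈ (0,1) and let φ' > 0. Then there exists a nonempty set of terminals T ⊆ V(G) with |T| ≤ min(n, ⌈c·n·φ'/ε²⌉) such that every set W ⊆ V(G) with ∅ ≠ W ≠ V(G) that satisfies either (a) |δ_G(W)| ≤ φ'·min(|W|, |V(G)∖W|), or (b) |δ_G(W)| ≤ (n/(10·|T|))·φ'·min(|W ∩ T|, |T ∖ W|), also satisfies |(n/|T|)·|W ∩ T| − |W|| ≤ ε·|W|. -/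
open Finset

attribute [local instance] Classical.propDecidable

/-- The number of edges of `G` with exactly one endpoint in `W`, i.e. `|δ_G(W)|`. -/
noncomputable def cutSize {V : Type*} (G : SimpleGraph V) (W : Finset V) : ℕ :=
  {e : Sym2 V | e ∈ G.edgeSet ∧ (∃ u ∈ e, u ∈ W) ∧ (∃ v ∈ e, v ∉ W)}.ncard

/-- The number of consecutive pairs of the sequence `p, l` that are separated by `W`. -/
noncomputable def crossings {V : Type*} (W : Finset V) : V → List V → ℕ
  | _, [] => 0
  | p, x :: l => (if p ∈ W ↔ x ∈ W then 0 else 1) + crossings W x l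

/-- Inserting `v` directly after `u` creates at most two new crossings, and only if `W`
separates `u` from `v`. -/
lemma exists_perm_cons_crossings_le {V : Type*} (u v : V) (l : List V) (p : V)
    (hu : u ∈ p :: l) :
    ∃ l' : List V, l'.Perm (v :: l) ∧ ∀ W : Finset V,
      crossings W p l' ≤ crossings W p l + 2 * (if u ∈ W ↔ v ∈ W then 0 else 1) := by
  by_cases hup : u = p
  · subst hup
    refine ⟨v :: l, List.Perm.refl _, fun W => ?_⟩
    cases l with
    | nil => simp only [crossings]; omega
    | cons x l =>
      simp only [crossings]
      by_cases h1 : u ∈ W <;> by_cases h2 : v ∈ W <;> by_cases h3 : x ∈ W <;>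
        simp [h1, h2, h3] <;> omega
  · induction l generalizing p with
    | nil => simp_all
    | cons x l ih =>
      have hx : u ∈ x :: l := by simpa [hup] using hu
      by_cases hux : u = x
      · subst hux
        refine ⟨u :: v :: l, List.Perm.swap _ _ _, fun W => ?_⟩
        cases l with
        | nil => simp only [crossings]; omega
        | cons y l =>
          simp only [crossings]
          by_cases h1 : u ∈ W <;> by_cases h2 : v ∈ W <;> by_cases h3 : y ∈ W <;>
            simp [h1, h2, h3] <;> omega
      · obtain ⟨l', hl', h⟩ := ih x hx hux
        refine ⟨x :: l', (hl'.cons x).trans (List.Perm.swap _ _ _), fun W => ?_⟩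
        have := h W
        simp only [crossings]
        omega

/-- In a connected graph, partial orderings of the vertices of every length exist whose crossings
are charged at most twice to edges spanned by the vertices listed. -/
lemma exists_list_crossings_le {V : Type*} [Fintype V] (G : SimpleGraph V) (hG : G.Connected)
    (p : V) (k : ℕ) (hk : k < Fintype.card V) :
    ∃ l : List V, (p :: l).Nodup ∧ l.length = k ∧ ∃ F : Finset (Sym2 V),
      (∀ e ∈ F, e ∈ G.edgeSet) ∧ (∀ e ∈ F, ∀ v ∈ e, v ∈ p :: l) ∧
      ∀ W : Finset V, crossings W p l ≤
        2 * #{e ∈ F | (∃ u ∈ e, u ∈ W) ∧ (∃ v ∈ e, v ∉ W)} := by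
  induction k with
  | zero => exact ⟨[], by simp, rfl, ∅, by simp, by simp, by simp [crossings]⟩
  | succ k ih =>
    obtain ⟨l, hnd, hlen, F, hFG, hFl, hW⟩ := ih (by omega)
    obtain ⟨z, hz⟩ : ∃ z, z ∉ p :: l := by
      by_contra! hall
      have h1 : (p :: l).toFinset = Finset.univ := by
        ext x
        simpa using hall x
      have h2 := List.toFinset_card_of_nodup hnd
      rw [h1, Finset.card_univ, List.length_cons] at h2
      omega
    obtain ⟨w⟩ := hG.preconnected p z
    obtain ⟨⟨⟨u, v⟩, hadj⟩, -, hu, hv⟩ :=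
      w.exists_boundary_dart {x | x ∈ p :: l} (by simp) hz
    change u ∈ p :: l at hu
    change v ∉ p :: l at hv
    obtain ⟨l', hl', hc⟩ := exists_perm_cons_crossings_le u v l p hu
    have hperm : (p :: l').Perm (v :: p :: l) := (hl'.cons p).trans (List.Perm.swap _ _ _)
    have hnot : s(u, v) ∉ F := fun h => hv (hFl _ h v (Sym2.mem_mk_right u v))
    refine ⟨l', hperm.nodup_iff.2 (List.nodup_cons.2 ⟨hv, hnd⟩), by simp [hl'.length_eq, hlen],
      insert s(u, v) F, ?_, ?_, fun W => ?_⟩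
    · intro e he
      rcases Finset.mem_insert.1 he with rfl | he
      · exact hadj
      · exact hFG e he
    · intro e he x hx
      rw [hperm.mem_iff]
      rcases Finset.mem_insert.1 he with rfl | he
      · rcases Sym2.mem_iff.1 hx with rfl | rfl
        · exact List.mem_cons_of_mem _ hu
        · exact List.mem_cons_self
      · exact List.mem_cons_of_mem _ (hFl e he x hx)
    · have h1 := hW W
      have h2 := hc W
      by_cases huv : u ∈ W ↔ v ∈ W
      · rw [if_pos huv] at h2
        have h3 := Finset.card_le_card (Finset.filter_subset_filter
          (fun e : Sym2 V => (∃ u ∈ e, u ∈ W) ∧ (∃ v ∈ e, v ∉ W))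
          (Finset.subset_insert s(u, v) F))
        omega
      · rw [if_neg huv] at h2
        rw [Finset.filter_insert, if_pos, Finset.card_insert_of_notMem]
        · omega
        · simp [hnot]
        · simp only [Sym2.mem_iff, exists_eq_or_imp, exists_eq_left]
          tauto

/-- A connected graph has a vertex ordering in which every cut has at most `2 * cutSize`
crossings. -/
lemma exists_ordering_crossings_le {V : Type*} [Fintype V] (G : SimpleGraph V)
    (hG : G.Connected) :
    ∃ (p : V) (l : List V), (p :: l).Nodup ∧ (∀ v, v ∈ p :: l) ∧
      ∀ W : Finset V, crossings W p l ≤ 2 * cutSize G W := by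
  obtain ⟨p⟩ := hG.nonempty
  have hpos : 0 < Fintype.card V := Fintype.card_pos_iff.2 ⟨p⟩
  obtain ⟨l, hnd, hlen, F, hFG, -, hW⟩ :=
    exists_list_crossings_le G hG p (Fintype.card V - 1) (by omega)
  refine ⟨p, l, hnd, fun v => ?_, fun W => (hW W).trans ?_⟩
  · have h : (p :: l).toFinset = Finset.univ := by
      rw [← Finset.card_eq_iff_eq_univ, List.toFinset_card_of_nodup hnd, List.length_cons]
      omega
    rw [← List.mem_toFinset, h]
    exact Finset.mem_univ v
  · gcongr
    rw [cutSize, ← Set.ncard_coe_finset]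
    refine Set.ncard_le_ncard (fun e he => ?_) (Set.toFinite _)
    obtain ⟨he, hc⟩ := Finset.mem_filter.1 (Finset.mem_coe.1 he)
    exact ⟨hFG e he, hc⟩

/-- Sampling a sequence at density `a` so that every prefix has discrepancy less than one:
the discrepancy of `W` is bounded by its number of crossings, up to boundary terms. The number `s`
is the discrepancy accumulated before the sequence starts. -/
lemma exists_sample_of_list {V : Type*} (a : ℝ) (ha : 0 ≤ a) (ha1 : a ≤ 1) (l : List V)
    (hl : l.Nodup) (p : V) (s : ℝ) (hs : 0 ≤ s) (hs1 : s < 1) :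
    ∃ T : Finset V, T ⊆ l.toFinset ∧ ∃ s' : ℝ, 0 ≤ s' ∧ s' < 1 ∧
      (#T : ℝ) - a * l.length = s' - s ∧ ∃ q : V, ∀ W : Finset V,
        |(#(W ∩ T) : ℝ) - a * #(W ∩ l.toFinset) - (if q ∈ W then s' else 0)
          + (if p ∈ W then s else 0)| ≤ crossings W p l := by
  induction l generalizing p s with
  | nil => exact ⟨∅, by simp, s, hs, hs1, by simp, p, fun W => by simp [crossings]⟩
  | cons x l ih =>
    obtain ⟨hx, hl⟩ := List.nodup_cons.1 hl
    have hxl : x ∉ l.toFinset := by simpa using hx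
    have hcard (W : Finset V) : (#(W ∩ (x :: l).toFinset) : ℝ) =
        #(W ∩ l.toFinset) + if x ∈ W then 1 else 0 := by
      rw [List.toFinset_cons]
      split_ifs with h
      · rw [Finset.inter_insert_of_mem h, Finset.card_insert_of_notMem (by simp [hx])]
        push_cast
        ring
      · rw [Finset.inter_insert_of_notMem h, add_zero]
    have hstep (W : Finset V) (b d : ℝ) (hd : |d + (if x ∈ W then b else 0)| ≤ crossings W x l) :
        |d + (if x ∈ W then b - s else 0) + (if p ∈ W then s else 0)| ≤
          crossings W p (x :: l) := by
      simp only [crossings]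
      push_cast
      rw [abs_le] at hd ⊢
      by_cases h1 : x ∈ W <;> by_cases h2 : p ∈ W <;> simp [h1, h2] at hd ⊢ <;>
        constructor <;> linarith
    by_cases hsa : a ≤ s
    · obtain ⟨T, hT, s', h0, h1, hc, q, hq⟩ := ih hl x (s - a) (by linarith) (by linarith)
      refine ⟨T, hT.trans (by simp), s', h0, h1, ?_, q, fun W => ?_⟩
      · rw [List.length_cons]
        push_cast
        linarith
      · rw [hcard]
        refine le_of_eq_of_le (congrArg _ ?_) (hstep W _ _ (hq W))
        split_ifs <;> ring
    · obtain ⟨T, hT, s', h0, h1, hc, q, hq⟩ := ih hl x (s - a + 1) (by linarith) (by linarith)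
      have hxT : x ∉ T := fun h => hxl (hT h)
      refine ⟨insert x T, ?_, s', h0, h1, ?_, q, fun W => ?_⟩
      · rw [List.toFinset_cons]
        exact Finset.insert_subset_insert x hT
      · rw [List.length_cons, Finset.card_insert_of_notMem hxT]
        push_cast
        linarith
      · have hcT : (#(W ∩ insert x T) : ℝ) = #(W ∩ T) + if x ∈ W then 1 else 0 := by
          split_ifs with h
          · rw [Finset.inter_insert_of_mem h, Finset.card_insert_of_notMem (by simp [hxT])]
            push_cast
            ring
          · rw [Finset.inter_insert_of_notMem h, add_zero]
        rw [hcard, hcT]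
        refine le_of_eq_of_le (congrArg _ ?_) (hstep W _ _ (hq W))
        split_ifs <;> ring

/-- A connected graph on `n` vertices has, for every `t` between `1` and `n`, a set of `t` vertices
whose discrepancy on every vertex set `W` is at most `2 * cutSize G W`. -/
lemma exists_sample_discrepancy_le_cutSize {V : Type*} [Fintype V] (G : SimpleGraph V)
    (hG : G.Connected) (t : ℕ) (ht : t ≤ Fintype.card V) :
    ∃ T : Finset V, #T = t ∧ ∀ W : Finset V,
      |(#(W ∩ T) : ℝ) - t / Fintype.card V * #W| ≤ 2 * cutSize G W := by
  obtain ⟨p, l, hnd, hmem, hW⟩ := exists_ordering_crossings_le G hG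
  have huniv : (p :: l).toFinset = Finset.univ := by
    ext v
    simpa using hmem v
  have hlen : (p :: l).length = Fintype.card V := by
    rw [← List.toFinset_card_of_nodup hnd, huniv, Finset.card_univ]
  have hpos : (0 : ℝ) < Fintype.card V := by
    rw [← hlen, List.length_cons]
    positivity
  obtain ⟨T, -, s', h0, h1, hc, q, hq⟩ := exists_sample_of_list
    ((t : ℝ) / Fintype.card V) (by positivity)
    ((div_le_one hpos).2 (by exact_mod_cast ht)) (p :: l) hnd p 0 le_rfl one_pos
  rw [hlen, div_mul_cancel₀ _ hpos.ne', sub_zero] at hc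
  have hTt : #T = t := by
    have h2 : (t : ℝ) ≤ #T := by linarith
    have h3 : (#T : ℝ) < t + 1 := by linarith
    norm_cast at h2 h3
    omega
  have hs' : s' = 0 := by rw [← hc, hTt, sub_self]
  refine ⟨T, hTt, fun W => ?_⟩
  have h := hq W
  rw [huniv, Finset.inter_univ, hs'] at h
  simp only [ite_self, sub_zero, add_zero, crossings, if_true, zero_add] at h
  exact h.trans (by exact_mod_cast hW W)

/-- Existence of edge sample sets for sparse cuts. -/
theorem edge_sample_sets :
    ∃ c : ℝ, 1 ≤ c ∧
      ∀ (V : Type) [Fintype V] (G : SimpleGraph V) (n : ℕ),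
        n = Fintype.card V → G.Connected → 1 ≤ n →
        ∀ ε φ' : ℝ, 0 < ε → ε < 1 → 0 < φ' →
          ∃ T : Finset V, T.Nonempty ∧
            (T.card : ℝ) ≤ min (n : ℝ) ((⌈c * n * φ' / ε ^ 2⌉ : ℤ) : ℝ) ∧
            ∀ W : Finset V, W.Nonempty → W ≠ Finset.univ →
              ((cutSize G W : ℝ) ≤ φ' * min (W.card : ℝ) ((Wᶜ).card : ℝ) ∨
                (cutSize G W : ℝ) ≤ ((n : ℝ) / (10 * (T.card : ℝ))) * φ' *
                  min ((W ∩ T).card : ℝ) ((T \ W).card : ℝ)) →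
              |((n : ℝ) / (T.card : ℝ)) * ((W ∩ T).card : ℝ) - (W.card : ℝ)| ≤
                ε * (W.card : ℝ) := by
  refine ⟨2, one_le_two, ?_⟩
  rintro V _ G n rfl hG hn ε φ' hε hε1 hφ
  set n := Fintype.card V with hndef
  have hn0 : (0 : ℝ) < n := by exact_mod_cast hn
  have hq : 0 < 2 * n * φ' / ε ^ 2 := by positivity
  set t := min n ⌈2 * n * φ' / ε ^ 2⌉₊ with ht
  have ht1 : 0 < t := lt_min hn (Nat.ceil_pos.2 hq)
  obtain ⟨T, hTt, hT⟩ := exists_sample_discrepancy_le_cutSize G hG t (min_le_left _ _)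
  refine ⟨T, Finset.card_pos.1 (by omega), ?_, fun W _ _ hcut => ?_⟩
  · rw [hTt, ← natCast_ceil_eq_intCast_ceil hq.le]
    exact_mod_cast ht.le
  · have hTW := hT W
    rw [hTt] at hcut ⊢
    have ht0 : (0 : ℝ) < t := by exact_mod_cast ht1
    rcases le_or_gt n ⌈2 * n * φ' / ε ^ 2⌉₊ with hle | hlt
    · have htn : t = n := min_eq_left hle
      have hTu : T = Finset.univ := by
        rw [← Finset.card_eq_iff_eq_univ, hTt, htn]
      rw [htn, hTu, Finset.inter_univ, div_self hn0.ne', one_mul, sub_self, abs_zero]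
      positivity
    · have htc : 2 * n * φ' / ε ^ 2 ≤ t := by
        rw [ht, min_eq_right hlt.le]
        exact Nat.le_ceil _
      set r : ℝ := n / t with hr
      have hr0 : 0 < r := by positivity
      have hrφ : 2 * (r * φ') ≤ ε := by
        rw [div_le_iff₀ (by positivity)] at htc
        have h1 : 2 * (r * φ') ≤ ε ^ 2 := by
          rw [hr, div_mul_eq_mul_div, mul_div_assoc', div_le_iff₀ ht0]
          linarith
        nlinarith
      have herr : |r * #(W ∩ T) - #W| ≤ r * (2 * cutSize G W) := by
        have h1 : r * #(W ∩ T) - #W = r * (#(W ∩ T) - t / n * #W) := by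
          rw [hr]
          field_simp
        rw [h1, abs_mul, abs_of_pos hr0]
        exact mul_le_mul_of_nonneg_left hTW hr0.le
      have hW0 : (0 : ℝ) ≤ #W := by positivity
      rcases hcut with hcut | hcut
      · have h1 : (cutSize G W : ℝ) ≤ φ' * #W :=
          hcut.trans (mul_le_mul_of_nonneg_left (min_le_left _ _) hφ.le)
        calc |r * #(W ∩ T) - #W| ≤ r * (2 * cutSize G W) := herr
          _ ≤ r * (2 * (φ' * #W)) := by gcongr
          _ = 2 * (r * φ') * #W := by ring
          _ ≤ ε * #W := by gcongr
      · have h1 : (cutSize G W : ℝ) ≤ n / (10 * t) * φ' * #(W ∩ T) :=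
          hcut.trans (mul_le_mul_of_nonneg_left (min_le_left _ _) (by positivity))
        have h2 : (n : ℝ) / (10 * t) = r / 10 := by
          rw [hr]
          field_simp
        rw [h2] at h1
        have h3 : |r * #(W ∩ T) - #W| ≤ ε / 10 * (r * #(W ∩ T)) :=
          calc |r * #(W ∩ T) - #W| ≤ r * (2 * cutSize G W) := herr
            _ ≤ r * (2 * (r / 10 * φ' * #(W ∩ T))) := by gcongr
            _ = 2 * (r * φ') / 10 * (r * #(W ∩ T)) := by ring
            _ ≤ ε / 10 * (r * #(W ∩ T)) := by gcongr
        have hx0 : 0 ≤ r * (#(W ∩ T) : ℝ) := by positivity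
        have h4 : r * (#(W ∩ T) : ℝ) ≤ 10 * #W := by
          have := (abs_le.1 h3).2
          nlinarith
        nlinarith
end

section
/- There is an absolute constant c ≥ 1 with the following property (existence of vertex sample sets for sparse vertex cuts). Let G be a connected finite simple graph on n ≥ 1 vertices, let ε ∈ (0,1) and let φ' ∈ (0, 1/2). Then there exists a nonempty set of terminals T ⊆ V(G) with |T| ≤ min(n, ⌈c·(n·φ'/ε²)·log(2 + n·φ'/ε³)⌉) such that the following holds: for every nonempty W ⊆ V(G) with V(G) ∖ (W ∪ N_G(W)) nonempty, such that the induced subgraph G[W] is connected or the induced subgraph G[V(G) ∖ (W ∪ N_G(W))] is connected, if W satisfies either (a) |N_G(W)| ≤ φ'·|W ∪ N_G(W)|, or (b) |N_G(W)| ≤ (n/(10·|T|))·φ'·|(W ∪ N_G(W)) ∩ T|, then |(n/|T|)·|W ∩ T| − |W|| ≤ ε·|W|. -/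
open Finset

attribute [local instance] Classical.propDecidable

/-- The vertex neighbourhood `N_G(W)`: vertices outside `W` adjacent to some vertex of `W`. -/
noncomputable def vNbr {V : Type*} [Fintype V] (G : SimpleGraph V) (W : Finset V) : Finset V :=
  Finset.univ.filter (fun v => v ∉ W ∧ ∃ u ∈ W, G.Adj u v)

section Forest

variable {V : Type*}

/-- `y` is an ancestor of `x` (or `x` itself) in the forest with parent function `p`. -/
def IsAncestor (p : V → V) (x y : V) : Prop := ∃ i : ℕ, p^[i] x = y

/-- `L` is a lowest common ancestor of `a` and `b`, where `d` is the depth function. -/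
def IsLowestCommonAncestor (p : V → V) (d : V → ℕ) (a b L : V) : Prop :=
  IsAncestor p a L ∧ IsAncestor p b L ∧ ∀ c, IsAncestor p a c → IsAncestor p b c → d c ≤ d L

lemma IsAncestor.refl (p : V → V) (x : V) : IsAncestor p x x := ⟨0, rfl⟩

lemma IsAncestor.trans {p : V → V} {x y z : V} (h : IsAncestor p x y) (h' : IsAncestor p y z) :
    IsAncestor p x z := by
  obtain ⟨i, rfl⟩ := h
  obtain ⟨j, rfl⟩ := h'
  exact ⟨j + i, Function.iterate_add_apply p j i x⟩

lemma IsAncestor.parent {p : V → V} {x y : V} (h : IsAncestor p x y) : IsAncestor p x (p y) :=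
  h.trans ⟨1, rfl⟩

lemma IsAncestor.total {p : V → V} {x y z : V} (h : IsAncestor p x y) (h' : IsAncestor p x z) :
    IsAncestor p y z ∨ IsAncestor p z y := by
  obtain ⟨i, rfl⟩ := h
  obtain ⟨j, rfl⟩ := h'
  rcases le_total i j with hij | hij
  · left
    exact ⟨j - i, by rw [← Function.iterate_add_apply, Nat.sub_add_cancel hij]⟩
  · right
    exact ⟨i - j, by rw [← Function.iterate_add_apply, Nat.sub_add_cancel hij]⟩

lemma IsAncestor.eq_or_parent {p : V → V} {x y : V} (h : IsAncestor p x y) :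
    x = y ∨ IsAncestor p (p x) y := by
  obtain ⟨i, rfl⟩ := h
  cases i with
  | zero => left; rfl
  | succ i => right; exact ⟨i, rfl⟩

lemma IsAncestor.depth_le {p : V → V} {d : V → ℕ} (hd : ∀ x, d (p x) = d x - 1) {x y : V}
    (h : IsAncestor p x y) : d y ≤ d x := by
  obtain ⟨i, rfl⟩ := h
  induction i with
  | zero => exact le_rfl
  | succ i ih =>
    rw [Function.iterate_succ_apply', hd]
    omega

lemma IsAncestor.eq_of_depth_le {p : V → V} {d : V → ℕ} (hd : ∀ x, d (p x) = d x - 1)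
    (h0 : ∀ x, d x = 0 → p x = x) {x y : V} (h : IsAncestor p x y) (hxy : d x ≤ d y) :
    x = y := by
  rcases h.eq_or_parent with h' | h'
  · exact h'
  · have h1 := h'.depth_le hd
    rw [hd] at h1
    have hx : d x = 0 := by omega
    obtain ⟨i, rfl⟩ := h
    exact (Function.iterate_fixed (h0 x hx) i).symm

lemma IsLowestCommonAncestor.self {p : V → V} {d : V → ℕ} (hd : ∀ x, d (p x) = d x - 1) (a : V) :
    IsLowestCommonAncestor p d a a a :=
  ⟨.refl p a, .refl p a, fun _ h _ => h.depth_le hd⟩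

lemma IsLowestCommonAncestor.isAncestor {p : V → V} {d : V → ℕ} (hd : ∀ x, d (p x) = d x - 1)
    (h0 : ∀ x, d x = 0 → p x = x) {a b L c : V} (hL : IsLowestCommonAncestor p d a b L)
    (ha : IsAncestor p a c) (hb : IsAncestor p b c) : IsAncestor p L c := by
  rcases hL.1.total ha with h | h
  · exact h
  · rw [h.eq_of_depth_le hd h0 (hL.2.2 c ha hb)]
    exact .refl p L

lemma IsLowestCommonAncestor.unique {p : V → V} {d : V → ℕ} (hd : ∀ x, d (p x) = d x - 1)
    (h0 : ∀ x, d x = 0 → p x = x) {a b L L' : V} (hL : IsLowestCommonAncestor p d a b L)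
    (hL' : IsLowestCommonAncestor p d a b L') : L = L' :=
  (hL.isAncestor hd h0 hL'.1 hL'.2.1).eq_of_depth_le hd h0 (hL'.2.2 L hL.1 hL.2.1)

variable [Fintype V]

lemma exists_isLowestCommonAncestor {p : V → V} (d : V → ℕ) {a b c : V}
    (ha : IsAncestor p a c) (hb : IsAncestor p b c) :
    ∃ L, IsLowestCommonAncestor p d a b L := by
  obtain ⟨L, hL, hmax⟩ := Finset.exists_max_image
    (univ.filter fun c => IsAncestor p a c ∧ IsAncestor p b c) d ⟨c, by simp [ha, hb]⟩
  simp only [mem_filter, mem_univ, true_and] at hL hmax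
  exact ⟨L, hL.1, hL.2, fun c h h' => hmax c ⟨h, h'⟩⟩

/-- The ancestors of a set `A` of vertices of a forest split into at most `|A|²` vertical paths, the
fibres of `D`, whose lowest vertices form the set `H` of branching vertices. -/
lemma exists_branching_set (p : V → V) (d : V → ℕ) (hd : ∀ x, d (p x) = d x - 1)
    (h0 : ∀ x, d x = 0 → p x = x) (A : Finset V) :
    ∃ (H : Finset V) (D : V → Finset V), H.card ≤ A.card ^ 2 ∧ A ⊆ H ∧ Set.InjOn D H ∧
      (∀ a ∈ A, ∀ v, IsAncestor p a v → D v ∈ H.image D) ∧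
      ∀ a ∈ A, ∀ v, IsAncestor p a v → p v ∉ H → D (p v) = D v := by
  set H : Finset V :=
    univ.filter fun L => ∃ a ∈ A, ∃ b ∈ A, IsLowestCommonAncestor p d a b L with hH
  have memH : ∀ L, L ∈ H ↔ ∃ a ∈ A, ∃ b ∈ A, IsLowestCommonAncestor p d a b L := by simp [hH]
  set D : V → Finset V := fun v => A.filter fun a => IsAncestor p a v with hD
  have memD : ∀ a v, a ∈ D v ↔ a ∈ A ∧ IsAncestor p a v := by simp [hD]
  refine ⟨H, D, ?_, ?_, ?_, ?_, ?_⟩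
  · choose! f hf g hg hfg using fun L => (memH L).1
    rw [sq, ← card_product]
    refine card_le_card_of_injOn (fun L => (f L, g L)) (fun L hL => ?_) fun L hL L' hL' h => ?_
    · simp only [coe_product, Set.mem_prod, mem_coe]
      exact ⟨hf L hL, hg L hL⟩
    · have h1 := hfg L hL
      have h2 := hfg L' hL'
      simp only [Prod.mk.injEq] at h
      rw [h.1, h.2] at h1
      exact h1.unique hd h0 h2
  · exact fun a ha => (memH a).2 ⟨a, ha, a, ha, .self hd a⟩
  · intro L hL L' hL' h
    obtain ⟨a, ha, b, hb, hab⟩ := (memH L).1 hL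
    obtain ⟨a', ha', b', hb', hab'⟩ := (memH L').1 hL'
    have key : ∀ x ∈ A, IsAncestor p x L ↔ IsAncestor p x L' := fun x hx => by
      have := Finset.ext_iff.1 h x
      simpa [memD, hx] using this
    have h1 := hab.isAncestor hd h0 ((key a ha).1 hab.1) ((key b hb).1 hab.2.1)
    have h2 := hab'.isAncestor hd h0 ((key a' ha').2 hab'.1) ((key b' hb').2 hab'.2.1)
    exact h1.eq_of_depth_le hd h0 (h2.depth_le hd)
  · intro a ha v hv
    have hex : ∀ b ∈ D v, ∃ L, IsLowestCommonAncestor p d a b L := fun b hb =>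
      exists_isLowestCommonAncestor d hv ((memD b v).1 hb).2
    choose! l hl using hex
    obtain ⟨b, hb, hmin⟩ := Finset.exists_min_image (D v) (fun b => d (l b))
      ⟨a, (memD a v).2 ⟨ha, hv⟩⟩
    have hbv := (memD b v).1 hb
    refine mem_image.2 ⟨l b, (memH _).2 ⟨a, ha, b, hbv.1, hl b hb⟩, ?_⟩
    ext x
    simp only [memD]
    refine and_congr_right fun hx =>
      ⟨fun h => h.trans ((hl b hb).isAncestor hd h0 hv hbv.2), fun h => ?_⟩
    have hxv := (memD x v).2 ⟨hx, h⟩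
    refine (hl x hxv).2.1.trans ?_
    rcases (hl x hxv).1.total (hl b hb).1 with h' | h'
    · exact h'
    · rw [h'.eq_of_depth_le hd h0 (hmin x hxv)]
      exact .refl p _
  · intro a ha v hv hpv
    ext x
    simp only [memD]
    refine and_congr_right fun hx => ⟨fun h => ?_, fun h => h.parent⟩
    by_contra hxv
    obtain ⟨L, hL⟩ := exists_isLowestCommonAncestor d hv.parent h
    rcases hv.total hL.1 with h1 | h1
    · rcases h1.eq_or_parent with rfl | h2
      · exact hxv hL.2.1
      · have := h2.eq_of_depth_le hd h0 (hL.2.2 _ hv.parent h)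
        exact hpv ((memH _).2 ⟨a, ha, x, hx, this ▸ hL⟩)
    · exact hxv (hL.2.1.trans h1)

end Forest

section Traces

lemma card_filter_card_le {α : Type*} (S : Finset α) (k : ℕ) :
    (S.powerset.filter fun s => s.card ≤ k).card ≤ (S.card + 1) ^ k := by
  have hsub : (S.powerset.filter fun s => s.card ≤ k) ⊆
      (range (k + 1)).biUnion fun j => S.powersetCard j := by
    intro s hs
    simp only [mem_filter, mem_powerset] at hs
    simp only [mem_biUnion, mem_range, mem_powersetCard]
    exact ⟨s.card, by omega, hs.1, rfl⟩
  calc _ ≤ _ := card_le_card hsub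
    _ ≤ ∑ j ∈ range (k + 1), (S.powersetCard j).card := card_biUnion_le
    _ ≤ ∑ j ∈ range (k + 1), S.card ^ j * 1 ^ (k - j) * k.choose j := by
        refine sum_le_sum fun j hj => ?_
        rw [card_powersetCard, one_pow, mul_one]
        exact (Nat.choose_le_pow _ _).trans
          (Nat.le_mul_of_pos_right _ (Nat.choose_pos (by simpa [Nat.lt_succ_iff] using hj)))
    _ = (S.card + 1) ^ k := by rw [add_pow]; simp

lemma card_image_le_card_image {α β γ : Type*} [DecidableEq β] [DecidableEq γ]
    (s : Finset α) (f : α → β) (g : α → γ)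
    (h : ∀ x ∈ s, ∀ y ∈ s, g x = g y → f x = f y) : (s.image f).card ≤ (s.image g).card := by
  rcases s.eq_empty_or_nonempty with rfl | ⟨x, -⟩
  · simp
  have : Nonempty α := ⟨x⟩
  choose! c hc hfc using fun b (hb : b ∈ s.image f) => mem_image.1 hb
  refine card_le_card_of_injOn (fun b => g (c b)) (fun b hb => ?_) fun b hb b' hb' hbb => ?_
  · exact mem_image_of_mem g (hc b hb)
  · rw [← hfc b hb, ← hfc b' hb']
    exact h _ (hc b hb) _ (hc b' hb') hbb

variable {V : Type*}

lemma exists_bfs_parent (G : SimpleGraph V) (a : V) :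
    ∃ p : V → V, (∀ x, G.dist a (p x) = G.dist a x - 1) ∧ (∀ x, G.dist a x = 0 → p x = x) ∧
      ∀ x, G.dist a x ≠ 0 → G.Adj (p x) x := by
  have key : ∀ x, ∃ y, G.dist a y = G.dist a x - 1 ∧ (G.dist a x = 0 → y = x) ∧
      (G.dist a x ≠ 0 → G.Adj y x) := by
    intro x
    by_cases h : G.dist a x = 0
    · exact ⟨x, by omega, fun _ => rfl, fun h' => absurd h h'⟩
    · have hr := (SimpleGraph.Reachable.of_dist_ne_zero h).symm
      obtain ⟨w, hw⟩ := hr.exists_walk_length_eq_dist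
      rw [SimpleGraph.dist_comm] at hw
      cases w with
      | nil => simp at h
      | @cons _ y _ hxy q =>
        rw [SimpleGraph.Walk.length_cons] at hw
        have h1 := SimpleGraph.dist_le q
        obtain ⟨q', hq'⟩ := q.reachable.exists_walk_length_eq_dist
        have h2 := SimpleGraph.dist_le (SimpleGraph.Walk.cons hxy q')
        rw [SimpleGraph.Walk.length_cons] at h2
        rw [SimpleGraph.dist_comm] at h1 hq' h2
        exact ⟨y, by omega, fun h' => absurd h' h, fun _ => hxy.symm⟩
  choose p h1 h2 h3 using key
  exact ⟨p, h1, h2, h3⟩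

/-- Every vertex of `W` can be reached from `a` along edges inside `W`. -/
def IsConnectedFrom (G : SimpleGraph V) (W : Finset V) (a : V) : Prop :=
  ∀ S : Set V, a ∈ S → (∀ x ∈ S, x ∈ W → ∀ y ∈ W, G.Adj x y → y ∈ S) → ∀ w ∈ W, w ∈ S

lemma isConnectedFrom_of_induce_connected {G : SimpleGraph V} {W : Finset V}
    (h : (G.induce (W : Set V)).Connected) {a : V} (ha : a ∈ W) : IsConnectedFrom G W a := by
  intro S haS hS w hw
  obtain ⟨q⟩ := h.preconnected ⟨a, ha⟩ ⟨w, hw⟩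
  have key : ∀ (x y : (W : Set V)), (G.induce (W : Set V)).Walk x y → (x : V) ∈ S → (y : V) ∈ S := by
    intro x y q
    induction q with
    | nil => exact id
    | @cons u v _ huv _ ih => exact fun hu => ih (hS u hu u.2 v v.2 huv)
  exact key _ _ q haS

lemma IsConnectedFrom.reachable {G : SimpleGraph V} {W : Finset V} {a w : V}
    (h : IsConnectedFrom G W a) (hw : w ∈ W) : G.Reachable a w :=
  h {x | G.Reachable a x} (SimpleGraph.Reachable.refl a)
    (fun _ hx _ _ _ hxy => SimpleGraph.Reachable.trans hx hxy.reachable) w hw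

lemma IsConnectedFrom.deleteIncidenceSet {G : SimpleGraph V} {W : Finset V} {a v : V}
    (h : IsConnectedFrom G W a) (hv : v ∉ W) :
    IsConnectedFrom (G.deleteIncidenceSet v) W a := by
  intro S haS hS
  refine h S haS fun x hx hxW y hyW hxy => hS x hx hxW y hyW ?_
  rw [SimpleGraph.deleteIncidenceSet_adj]
  exact ⟨hxy, fun e => hv (e ▸ hxW), fun e => hv (e ▸ hyW)⟩

variable [Fintype V]

lemma mem_vNbr {G : SimpleGraph V} {W : Finset V} {v : V} :
    v ∈ vNbr G W ↔ v ∉ W ∧ ∃ u ∈ W, G.Adj u v := by simp [vNbr]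

lemma mem_iff_mem_of_adj {G : SimpleGraph V} {W : Finset V} {u v : V} (h : G.Adj u v)
    (hu : u ∉ vNbr G W) (hv : v ∉ vNbr G W) : u ∈ W ↔ v ∈ W := by
  simp only [mem_vNbr, not_and_or, not_not] at hu hv
  constructor
  · intro huW
    exact hv.resolve_right fun h' => h' ⟨u, huW, h⟩
  · intro hvW
    exact hu.resolve_right fun h' => h' ⟨v, hvW, h.symm⟩

lemma vNbr_deleteIncidenceSet_subset (G : SimpleGraph V) (W : Finset V) (v : V) :
    vNbr (G.deleteIncidenceSet v) W ⊆ (vNbr G W).erase v := by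
  intro x hx
  obtain ⟨hxW, u, hu, hux⟩ := mem_vNbr.1 hx
  rw [SimpleGraph.deleteIncidenceSet_adj] at hux
  exact mem_erase.2 ⟨hux.2.2, mem_vNbr.2 ⟨hxW, u, hu, hux.1⟩⟩

/-- Sets connected from `a` with at most `k` neighbours, none of them in a suitable set `H` of
`|A|²` vertices, have few traces on `A`. -/
lemma exists_card_traces_le (G : SimpleGraph V) (A : Finset V) (a : V) (k : ℕ) :
    ∃ H : Finset V, H.card ≤ A.card ^ 2 ∧
      ((univ.filter fun W => a ∈ W ∧ IsConnectedFrom G W a ∧ (vNbr G W).card ≤ k ∧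
        Disjoint (vNbr G W) H).image (· ∩ A)).card ≤ ((A.card ^ 2 + 1) ^ 2) ^ k := by
  obtain ⟨p, hd, h0, hadj⟩ := exists_bfs_parent G a
  obtain ⟨H, D, hcard, hAH, hinj, hDmem, hDp⟩ := exists_branching_set p (G.dist a) hd h0 A
  refine ⟨H, hcard, ?_⟩
  set τ : Finset V := univ.filter fun v => ∃ b ∈ A, IsAncestor p b v with hτ
  have memτ : ∀ v, v ∈ τ ↔ ∃ b ∈ A, IsAncestor p b v := by simp [hτ]
  set cut : Finset V → Finset (Finset V) := fun W => (vNbr G W ∩ τ).image D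
  set inner : Finset V → Finset (Finset V) := fun W => (H ∩ W).image D ∩ cut W
  set P := ((H.image D).powerset.filter fun s => s.card ≤ k) with hP
  have hPcard : P.card ≤ (A.card ^ 2 + 1) ^ k :=
    (card_filter_card_le _ k).trans
      (Nat.pow_le_pow_left (Nat.succ_le_succ (card_image_le.trans hcard)) k)
  calc _ ≤ _ := card_image_le_card_image _ _ (fun W => (cut W, inner W)) ?_
    _ ≤ (P ×ˢ P).card := card_le_card ?_
    _ ≤ ((A.card ^ 2 + 1) ^ 2) ^ k := by
      rw [card_product, ← pow_mul, mul_comm 2 k, pow_mul, sq ((A.card ^ 2 + 1) ^ k)]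
      exact Nat.mul_le_mul hPcard hPcard
  · intro W hW W' hW' hWW
    simp only [mem_filter, mem_univ, true_and, Finset.disjoint_left] at hW hW'
    obtain ⟨haW, hconn, -, hdisj⟩ := hW
    obtain ⟨haW', hconn', -, hdisj'⟩ := hW'
    obtain ⟨hcutEq, hinnerEq⟩ := Prod.mk.inj hWW
    have step : ∀ W : Finset V, (∀ ⦃v⦄, v ∈ vNbr G W → v ∉ H) → ∀ v ∈ τ, D v ∉ cut W →
        G.dist a v ≠ 0 → (v ∈ W ↔ p v ∈ W) := by
      intro W hdisj v hv hcv hv0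
      refine (mem_iff_mem_of_adj (hadj v hv0) (fun h => ?_) fun h => ?_).symm
      · obtain ⟨b, hb, hbv⟩ := (memτ v).1 hv
        have hpv : p v ∈ τ := (memτ _).2 ⟨b, hb, hbv.parent⟩
        rw [← hDp b hb v hbv (hdisj h)] at hcv
        exact hcv (mem_image_of_mem D (mem_inter.2 ⟨h, hpv⟩))
      · exact hcv (mem_image_of_mem D (mem_inter.2 ⟨h, hv⟩))
    have color : ∀ v ∈ H, D v ∈ cut W → (v ∈ W ↔ v ∈ W') := by
      have aux : ∀ W : Finset V, ∀ v ∈ H, D v ∈ cut W → (v ∈ W ↔ D v ∈ inner W) := by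
        intro W v hv hcv
        constructor
        · exact fun h => mem_inter.2 ⟨mem_image_of_mem D (mem_inter.2 ⟨hv, h⟩), hcv⟩
        · intro h
          obtain ⟨u, hu, huv⟩ := mem_image.1 (mem_inter.1 h).1
          rw [mem_inter] at hu
          exact hinj hu.1 hv huv ▸ hu.2
      intro v hv hcv
      rw [aux W v hv hcv, hinnerEq]
      exact (aux W' v hv (hcutEq ▸ hcv)).symm
    have main : ∀ n, ∀ v ∈ τ, G.dist a v = n → (v ∈ H ∨ D v ∉ cut W) →
        (v ∈ W ↔ v ∈ W') := by
      intro n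
      induction n with
      | zero =>
        intro v _ hvn _
        rcases SimpleGraph.dist_eq_zero_iff_eq_or_not_reachable.1 hvn with rfl | hr
        · simp [haW, haW']
        · exact iff_of_false (fun h => hr (hconn.reachable h)) fun h => hr (hconn'.reachable h)
      | succ n ih =>
        intro v hv hvn hor
        by_cases hcv : D v ∈ cut W
        · exact color v (hor.resolve_right (not_not.2 hcv)) hcv
        · obtain ⟨b, hb, hbv⟩ := (memτ v).1 hv
          rw [step W hdisj v hv hcv (by omega), step W' hdisj' v hv (hcutEq ▸ hcv) (by omega)]
          refine ih (p v) ((memτ _).2 ⟨b, hb, hbv.parent⟩) (by rw [hd, hvn]; rfl) ?_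
          refine or_iff_not_imp_left.2 fun h => ?_
          rwa [hDp b hb v hbv h]
    ext v
    simp only [mem_inter]
    exact and_congr_left fun hv =>
      main _ v ((memτ v).2 ⟨v, hv, .refl p v⟩) rfl (Or.inl (hAH hv))
  · intro x hx
    obtain ⟨W, hW, rfl⟩ := mem_image.1 hx
    simp only [mem_filter, mem_univ, true_and] at hW
    have hc : (cut W).card ≤ k :=
      card_image_le.trans ((card_le_card inter_subset_left).trans hW.2.2.1)
    have hs : cut W ⊆ H.image D := by
      intro y hy
      obtain ⟨v, hv, rfl⟩ := mem_image.1 hy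
      obtain ⟨b, hb, hbv⟩ := (memτ v).1 (mem_inter.1 hv).2
      exact hDmem b hb v hbv
    simp only [hP, mem_product, mem_filter, mem_powerset]
    exact ⟨⟨hs, hc⟩, inter_subset_right.trans hs, (card_le_card inter_subset_right).trans hc⟩

lemma card_traces_isConnectedFrom_le (A : Finset V) (a : V) (k : ℕ) (G : SimpleGraph V) :
    ((univ.filter fun W => a ∈ W ∧ IsConnectedFrom G W a ∧ (vNbr G W).card ≤ k).image
      (· ∩ A)).card ≤ (2 * (A.card ^ 2 + 1) ^ 2) ^ k := by
  induction k generalizing G with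
  | zero =>
    obtain ⟨H, -, hH⟩ := exists_card_traces_le G A a 0
    refine (card_le_card (image_subset_image fun W hW => ?_)).trans hH
    simp only [mem_filter, mem_univ, true_and, Nat.le_zero, card_eq_zero] at hW ⊢
    exact ⟨hW.1, hW.2.1, hW.2.2, by simp [hW.2.2]⟩
  | succ k ih =>
    obtain ⟨H, hcard, hH⟩ := exists_card_traces_le G A a (k + 1)
    have hsub : ((univ.filter fun W => a ∈ W ∧ IsConnectedFrom G W a ∧
        (vNbr G W).card ≤ k + 1).image (· ∩ A)) ⊆
        ((univ.filter fun W => a ∈ W ∧ IsConnectedFrom G W a ∧ (vNbr G W).card ≤ k + 1 ∧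
          Disjoint (vNbr G W) H).image (· ∩ A)) ∪
        H.biUnion fun v => ((univ.filter fun W => a ∈ W ∧
          IsConnectedFrom (G.deleteIncidenceSet v) W a ∧
          (vNbr (G.deleteIncidenceSet v) W).card ≤ k).image (· ∩ A)) := by
      intro x hx
      obtain ⟨W, hW, rfl⟩ := mem_image.1 hx
      simp only [mem_filter, mem_univ, true_and] at hW
      obtain ⟨haW, hconn, hk⟩ := hW
      by_cases hdisj : Disjoint (vNbr G W) H
      · refine mem_union_left _ (mem_image_of_mem _ ?_)
        simp [haW, hconn, hk, hdisj]
      · obtain ⟨v, hv, hvH⟩ := not_disjoint_iff.1 hdisj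
        refine mem_union_right _ (mem_biUnion.2 ⟨v, hvH, mem_image_of_mem _ ?_⟩)
        simp only [mem_filter, mem_univ, true_and]
        refine ⟨haW, hconn.deleteIncidenceSet (mem_vNbr.1 hv).1, ?_⟩
        have := card_le_card (vNbr_deleteIncidenceSet_subset G W v)
        rw [card_erase_of_mem hv] at this
        omega
    refine (card_le_card hsub).trans ((card_union_le _ _).trans ?_)
    set Q := A.card ^ 2 + 1 with hQ
    have h1 := (card_biUnion_le (s := H) (t := fun v => ((univ.filter fun W => a ∈ W ∧
          IsConnectedFrom (G.deleteIncidenceSet v) W a ∧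
          (vNbr (G.deleteIncidenceSet v) W).card ≤ k).image (· ∩ A)))).trans
      (sum_le_card_nsmul H _ _ fun v _ => ih (G.deleteIncidenceSet v))
    have h2 : H.card • (2 * Q ^ 2) ^ k ≤ Q ^ 2 * (2 * Q ^ 2) ^ k := by
      rw [smul_eq_mul]
      exact Nat.mul_le_mul_right _ (by nlinarith)
    have h3 : (Q ^ 2) ^ (k + 1) ≤ Q ^ 2 * (2 * Q ^ 2) ^ k := by
      rw [pow_succ, mul_comm]
      exact Nat.mul_le_mul_left _ (Nat.pow_le_pow_left (by omega) k)
    calc _ ≤ Q ^ 2 * (2 * Q ^ 2) ^ k + Q ^ 2 * (2 * Q ^ 2) ^ k :=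
          add_le_add (hH.trans h3) (h1.trans h2)
      _ = (2 * Q ^ 2) ^ (k + 1) := by ring

lemma card_traces_connected_le (G : SimpleGraph V) (A : Finset V) (k : ℕ) :
    ((univ.filter fun W => (vNbr G W).card ≤ k ∧ ∀ a ∈ W, IsConnectedFrom G W a).image
      (· ∩ A)).card ≤ 1 + A.card * (2 * (A.card ^ 2 + 1) ^ 2) ^ k := by
  have hsub : ((univ.filter fun W => (vNbr G W).card ≤ k ∧
      ∀ a ∈ W, IsConnectedFrom G W a).image (· ∩ A)) ⊆ {∅} ∪ A.biUnion fun a =>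
      ((univ.filter fun W => a ∈ W ∧ IsConnectedFrom G W a ∧ (vNbr G W).card ≤ k).image
        (· ∩ A)) := by
    intro x hx
    obtain ⟨W, hW, rfl⟩ := mem_image.1 hx
    simp only [mem_filter, mem_univ, true_and] at hW
    rcases (W ∩ A).eq_empty_or_nonempty with h | ⟨a, ha⟩
    · simp [h]
    · rw [mem_inter] at ha
      refine mem_union_right _ (mem_biUnion.2 ⟨a, ha.2, mem_image_of_mem _ ?_⟩)
      simp [ha.1, hW.1, hW.2 a ha.1]
  refine (card_le_card hsub).trans ((card_union_le _ _).trans ?_)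
  rw [card_singleton]
  exact Nat.add_le_add_left ((card_biUnion_le).trans
    (sum_le_card_nsmul A _ _ fun a _ => card_traces_isConnectedFrom_le A a k G)) 1

/-- The sets with at most `k` neighbours which are connected or leave a connected rest. -/
noncomputable def cutFamily (G : SimpleGraph V) (k : ℕ) : Finset (Finset V) :=
  univ.filter fun W => (vNbr G W).card ≤ k ∧
    ((∀ a ∈ W, IsConnectedFrom G W a) ∨
      ∀ a ∈ univ \ (W ∪ vNbr G W), IsConnectedFrom G (univ \ (W ∪ vNbr G W)) a)

lemma vNbr_sdiff_subset (G : SimpleGraph V) (W : Finset V) :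
    vNbr G (univ \ (W ∪ vNbr G W)) ⊆ vNbr G W := by
  intro v hv
  obtain ⟨hv, u, hu, huv⟩ := mem_vNbr.1 hv
  simp only [mem_sdiff, mem_univ, true_and, mem_union, not_or, not_and, not_not] at hv hu
  by_cases hvW : v ∈ W
  · exact absurd (mem_vNbr.2 ⟨hu.1, v, hvW, huv.symm⟩) hu.2
  · exact hv hvW

lemma card_traces_cutFamily_le (G : SimpleGraph V) (A : Finset V) {k : ℕ} (hk : 1 ≤ k)
    (hA : 2 ≤ A.card) :
    ((cutFamily G k).image (· ∩ A)).card ≤ A.card ^ (12 * k) := by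
  set F := ((univ.filter fun W => (vNbr G W).card ≤ k ∧
    ∀ a ∈ W, IsConnectedFrom G W a).image (· ∩ A)) with hF
  have hsub : (cutFamily G k).image (· ∩ A) ⊆ F ∪
      (F ×ˢ (A.powerset.filter fun s => s.card ≤ k)).image fun x => (A \ x.1) \ x.2 := by
    intro x hx
    obtain ⟨W, hW, rfl⟩ := mem_image.1 hx
    simp only [cutFamily, mem_filter, mem_univ, true_and] at hW
    rcases hW.2 with h | h
    · refine mem_union_left _ (mem_image_of_mem _ ?_)
      simpa using ⟨hW.1, h⟩
    · refine mem_union_right _ (mem_image.2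
        ⟨((univ \ (W ∪ vNbr G W)) ∩ A, vNbr G W ∩ A), mem_product.2 ⟨mem_image_of_mem _ ?_, ?_⟩, ?_⟩)
      · rw [mem_filter]
        exact ⟨mem_univ _, (card_le_card (vNbr_sdiff_subset G W)).trans hW.1, h⟩
      · rw [mem_filter, mem_powerset]
        exact ⟨inter_subset_right, (card_le_card inter_subset_left).trans hW.1⟩
      · ext v
        have : v ∈ vNbr G W → v ∉ W := fun h => (mem_vNbr.1 h).1
        simp only [mem_sdiff, mem_inter, mem_univ, mem_union, true_and]
        tauto
  set m := A.card with hm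
  have hFc : F.card ≤ 1 + m * (2 * (m ^ 2 + 1) ^ 2) ^ k := card_traces_connected_le G A k
  have hQ : 2 * (m ^ 2 + 1) ^ 2 ≤ m ^ 7 := by
    have h1 : m ^ 2 + 1 ≤ m ^ 3 := by nlinarith [Nat.pow_le_pow_left hA 2]
    calc 2 * (m ^ 2 + 1) ^ 2 ≤ m * (m ^ 3) ^ 2 := Nat.mul_le_mul hA (Nat.pow_le_pow_left h1 2)
      _ = m ^ 7 := by ring
  have hpos : 1 ≤ m := by omega
  have h1 : F.card ≤ m ^ (7 * k + 2) := by
    calc F.card ≤ 1 + m * (2 * (m ^ 2 + 1) ^ 2) ^ k := hFc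
      _ ≤ 1 + m * (m ^ 7) ^ k := by gcongr
      _ = 1 + m ^ (7 * k + 1) := by ring
      _ ≤ m ^ (7 * k + 1) * m := by
        nlinarith [Nat.one_le_pow (7 * k + 1) m hpos]
      _ = m ^ (7 * k + 2) := by ring
  have h2 : (m + 1) ^ k + 1 ≤ m ^ (2 * k + 1) := by
    calc (m + 1) ^ k + 1 ≤ (m ^ 2) ^ k + 1 := by gcongr; nlinarith
      _ = m ^ (2 * k) + 1 := by ring
      _ ≤ m ^ (2 * k) * m := by nlinarith [Nat.one_le_pow (2 * k) m hpos]
      _ = m ^ (2 * k + 1) := by ring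
  calc _ ≤ _ := card_le_card hsub
    _ ≤ F.card + F.card * (m + 1) ^ k := by
      refine (card_union_le _ _).trans (Nat.add_le_add_left (card_image_le.trans ?_) _)
      rw [card_product]
      exact Nat.mul_le_mul_left _ (card_filter_card_le A k)
    _ = F.card * ((m + 1) ^ k + 1) := by ring
    _ ≤ m ^ (7 * k + 2) * m ^ (2 * k + 1) := Nat.mul_le_mul h1 h2
    _ = m ^ (7 * k + 2 + (2 * k + 1)) := (pow_add _ _ _).symm
    _ ≤ m ^ (12 * k) := Nat.pow_le_pow_right hpos (by omega)

end Traces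

section Halving

variable {V : Type*}

lemma sum_exp_discrepancy_le {A P : Finset V} (hP : P ⊆ A) (s : ℝ) :
    ∑ B ∈ A.powerset, Real.exp (s * (2 * ((P ∩ B).card : ℝ) - P.card)) ≤
      2 ^ A.card * Real.exp (s ^ 2 * P.card / 2) := by
  have hprod : ∀ (S : Finset V) (x : ℝ),
      ∏ v ∈ S, (if v ∈ P then Real.exp x else 1) = Real.exp (x * (P ∩ S).card) := by
    intro S x
    rw [prod_ite, prod_const, prod_const_one, mul_one, ← Real.exp_nat_mul, filter_mem_eq_inter,
      inter_comm, mul_comm]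
  have hterm : ∀ B ∈ A.powerset, Real.exp (s * (2 * ((P ∩ B).card : ℝ) - P.card)) =
      (∏ v ∈ B, (if v ∈ P then Real.exp s else 1)) *
        ∏ v ∈ A \ B, (if v ∈ P then Real.exp (-s) else 1) := by
    intro B hB
    rw [hprod, hprod, ← Real.exp_add]
    have h1 : (P ∩ (A \ B)).card + (P ∩ B).card = P.card := by
      rw [← card_union_of_disjoint, ← inter_union_distrib_left,
        sdiff_union_of_subset (mem_powerset.1 hB), inter_eq_left.2 hP]
      exact disjoint_of_subset_left inter_subset_right
        (disjoint_of_subset_right inter_subset_right sdiff_disjoint)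
    rw [← h1]
    push_cast
    congr 1
    ring
  rw [sum_congr rfl hterm, ← prod_add]
  calc _ = ∏ v ∈ A, 2 * (if v ∈ P then Real.cosh s else 1) := by
        refine prod_congr rfl fun v _ => ?_
        split_ifs
        · rw [Real.cosh_eq]; ring
        · norm_num
    _ = 2 ^ A.card * Real.cosh s ^ P.card := by
        rw [prod_mul_distrib, prod_const, prod_ite, prod_const, prod_const_one, mul_one,
          filter_mem_eq_inter, inter_eq_right.2 hP]
    _ ≤ 2 ^ A.card * Real.exp (s ^ 2 / 2) ^ P.card := by
        gcongr
        exact Real.cosh_le_exp_half_sq s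
    _ = _ := by
        rw [← Real.exp_nat_mul]
        congr 2
        ring

lemma card_large_discrepancy_le {A P : Finset V} (hP : P ⊆ A) {t : ℝ} (ht : 0 ≤ t) :
    ((A.powerset.filter fun B =>
      2 * (P.card : ℝ) * t < (2 * ((P ∩ B).card : ℝ) - P.card) ^ 2).card : ℝ) ≤
      2 ^ A.card * (2 * Real.exp (-t)) := by
  rcases P.eq_empty_or_nonempty with rfl | hne
  · simp only [card_empty, CharP.cast_eq_zero, empty_inter]
    norm_num
    positivity
  have hp : (0 : ℝ) < P.card := by exact_mod_cast hne.card_pos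
  set s := Real.sqrt (2 * t / P.card)
  have hs2 : s ^ 2 = 2 * t / P.card := Real.sq_sqrt (by positivity)
  set bad := A.powerset.filter fun B =>
      2 * (P.card : ℝ) * t < (2 * ((P ∩ B).card : ℝ) - P.card) ^ 2
  have h1 : (bad.card : ℝ) * Real.exp (2 * t) ≤ ∑ B ∈ A.powerset,
      (Real.exp (s * (2 * ((P ∩ B).card : ℝ) - P.card)) +
        Real.exp (-s * (2 * ((P ∩ B).card : ℝ) - P.card))) := by
    rw [← nsmul_eq_mul]
    refine (card_nsmul_le_sum bad _ _ fun B hB => ?_).trans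
      (sum_le_sum_of_subset_of_nonneg (filter_subset _ _) fun _ _ _ => by positivity)
    have hB' := (mem_filter.1 hB).2
    set u := 2 * ((P ∩ B).card : ℝ) - P.card
    have hsu : (2 * t) ^ 2 ≤ (s * u) ^ 2 := by
      rw [mul_pow s u, hs2]
      calc (2 * t) ^ 2 = 2 * t / P.card * (2 * P.card * t) := by field_simp
        _ ≤ _ := by gcongr
    have habs := sq_le_sq.1 hsu
    rw [abs_of_nonneg (by positivity : 0 ≤ 2 * t)] at habs
    rcases le_abs.1 habs with h | h
    · have := Real.exp_le_exp.2 h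
      have := Real.exp_pos (-s * u)
      linarith
    · rw [← neg_mul] at h
      have := Real.exp_le_exp.2 h
      have := Real.exp_pos (s * u)
      linarith
  have h2 : (bad.card : ℝ) * Real.exp (2 * t) ≤ 2 ^ A.card * (2 * Real.exp t) := by
    refine h1.trans ?_
    rw [sum_add_distrib]
    have e1 := sum_exp_discrepancy_le hP s
    have e2 := sum_exp_discrepancy_le hP (-s)
    have e3 : s ^ 2 * P.card / 2 = t := by
      rw [hs2]; field_simp
    rw [neg_sq] at e2
    rw [e3] at e1 e2
    linarith
  have h3 : Real.exp (-t) * Real.exp (2 * t) = Real.exp t := by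
    rw [← Real.exp_add]; congr 1; ring
  refine le_of_mul_le_mul_right ?_ (Real.exp_pos (2 * t))
  calc _ ≤ _ := h2
    _ = _ := by rw [← h3]; ring

lemma sum_geometric_sixteenth_lt (K : ℕ) : ∑ k ∈ range K, 2 * ((1 : ℝ) / 16) ^ (k + 1) < 1 := by
  have h : ∑ k ∈ range K, 2 * ((1 : ℝ) / 16) ^ (k + 1) = 2 / 15 * (1 - (1 / 16) ^ K) := by
    induction K with
    | zero => simp
    | succ K ih => rw [sum_range_succ, ih]; ring
  rw [h]
  have : (0 : ℝ) < (1 / 16) ^ K := by positivity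
  linarith

lemma exists_halving (𝓕 : ℕ → Finset (Finset V)) (A : Finset V) (K : ℕ) (hA : 2 ≤ A.card)
    (h𝓕 : ∀ k, 1 ≤ k → ((𝓕 k).image (· ∩ A)).card ≤ A.card ^ (12 * k)) :
    ∃ B ⊆ A, ∀ k, 1 ≤ k → k ≤ K → ∀ W ∈ 𝓕 k,
      (2 * ((W ∩ B).card : ℝ) - (W ∩ A).card) ^ 2 ≤
        32 * (W ∩ A).card * k * Real.log A.card := by
  have hm : (2 : ℝ) ≤ A.card := by exact_mod_cast hA
  have hm0 : (0 : ℝ) < A.card := by linarith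
  set bad : ℕ → Finset V → Finset (Finset V) := fun k P => A.powerset.filter fun B =>
      2 * (P.card : ℝ) * (16 * ((k : ℝ) * Real.log A.card)) <
        (2 * ((P ∩ B).card : ℝ) - P.card) ^ 2
  set U := (range K).biUnion fun k => ((𝓕 (k + 1)).image (· ∩ A)).biUnion (bad (k + 1))
  have hlog : 0 ≤ Real.log A.card := Real.log_nonneg (by linarith)
  have hk : ∀ k : ℕ, ((((𝓕 (k + 1)).image (· ∩ A)).biUnion (bad (k + 1))).card : ℝ) ≤
      2 ^ A.card * (2 * (1 / 16) ^ (k + 1)) := by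
    intro k
    have hexp : Real.exp (-(16 * (((k + 1 : ℕ) : ℝ) * Real.log A.card))) =
        ((A.card : ℝ) ^ (16 * (k + 1)))⁻¹ := by
      rw [Real.exp_neg, ← mul_assoc]
      congr 1
      have : (16 : ℝ) * ((k + 1 : ℕ) : ℝ) = ((16 * (k + 1) : ℕ) : ℝ) := by push_cast; ring
      rw [this, Real.exp_nat_mul, Real.exp_log hm0]
    calc _ ≤ ∑ P ∈ (𝓕 (k + 1)).image (· ∩ A), ((bad (k + 1) P).card : ℝ) := by
          exact_mod_cast card_biUnion_le
      _ ≤ ∑ P ∈ (𝓕 (k + 1)).image (· ∩ A),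
          2 ^ A.card * (2 * ((A.card : ℝ) ^ (16 * (k + 1)))⁻¹) := by
        refine sum_le_sum fun P hP => ?_
        rw [← hexp]
        obtain ⟨W, -, rfl⟩ := mem_image.1 hP
        exact card_large_discrepancy_le inter_subset_right (by positivity)
      _ ≤ (A.card : ℝ) ^ (12 * (k + 1)) *
          (2 ^ A.card * (2 * ((A.card : ℝ) ^ (16 * (k + 1)))⁻¹)) := by
        rw [sum_const, nsmul_eq_mul]
        gcongr
        exact_mod_cast h𝓕 (k + 1) (by omega)
      _ = 2 ^ A.card * (2 * (1 / (A.card : ℝ) ^ 4) ^ (k + 1)) := by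
        rw [show 16 * (k + 1) = 12 * (k + 1) + 4 * (k + 1) by ring, pow_add, one_div, inv_pow,
          ← pow_mul]
        field_simp
      _ ≤ _ := by
        gcongr
        calc (16 : ℝ) = 2 ^ 4 := by norm_num
          _ ≤ _ := by gcongr
  have hUcard : (U.card : ℝ) < (A.powerset.card : ℝ) := by
    calc (U.card : ℝ) ≤ ∑ k ∈ range K,
          ((((𝓕 (k + 1)).image (· ∩ A)).biUnion (bad (k + 1))).card : ℝ) := by
          exact_mod_cast card_biUnion_le
      _ ≤ ∑ k ∈ range K, 2 ^ A.card * (2 * ((1 : ℝ) / 16) ^ (k + 1)) := sum_le_sum fun k _ => hk k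
      _ < 2 ^ A.card * 1 := by
        rw [← mul_sum]
        gcongr
        exact sum_geometric_sixteenth_lt K
      _ = _ := by rw [card_powerset]; norm_num
  obtain ⟨B, hB, hBU⟩ := exists_mem_notMem_of_card_lt_card (by exact_mod_cast hUcard : U.card < _)
  have hBA := mem_powerset.1 hB
  refine ⟨B, hBA, fun k hk1 hkK W hW => ?_⟩
  by_contra hlt
  refine hBU (mem_biUnion.2 ⟨k - 1, mem_range.2 (by omega), ?_⟩)
  rw [Nat.sub_add_cancel hk1]
  refine mem_biUnion.2 ⟨W ∩ A, mem_image_of_mem _ hW, mem_filter.2 ⟨hB, ?_⟩⟩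
  rw [inter_assoc, inter_eq_right.2 hBA]
  rw [not_le] at hlt
  refine lt_of_le_of_lt (le_of_eq ?_) hlt
  ring

end Halving

section Iteration

lemma one_add_le_two_mul_pow (j : ℕ) : (1 + j : ℝ) ≤ 2 * (81 / 50) ^ j := by
  have h := one_add_mul_le_pow (by norm_num : (-2 : ℝ) ≤ 31 / 50) j
  have h' : (1 + 31 / 50 : ℝ) = 81 / 50 := by norm_num
  rw [h'] at h
  have : (0 : ℝ) ≤ j := j.cast_nonneg
  linarith

variable {V : Type*} [Fintype V]

/-- Halving repeatedly with `exists_halving`, starting from all vertices: the accumulated error is a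
geometric sum dominated by its last term. -/
lemma exists_iterated_halving (𝓕 : ℕ → Finset (Finset V))
    (h𝓕 : ∀ A : Finset V, 2 ≤ A.card → ∀ k, 1 ≤ k →
      ((𝓕 k).image (· ∩ A)).card ≤ A.card ^ (12 * k))
    (huniv : univ ∈ 𝓕 1) {K : ℕ} (hK : 1 ≤ K) {n φ η M : ℝ} {s : ℕ}
    (hn : n = Fintype.card V) (hφ : 0 < φ) (hnφ : 1 ≤ n * φ) (hη : 0 < η) (hη' : η ≤ 1 / 40)
    (hM : 4 ≤ M) (hnM : n = 2 ^ s * M) (hlog : 256 * 2 ^ s * φ * Real.log (2 * M) ≤ η ^ 2)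
    (i j : ℕ) (hij : i + j = s) :
    ∃ A : Finset V, ∀ k, 1 ≤ k → k ≤ K → ∀ W ∈ 𝓕 k,
      |2 ^ i * ((W ∩ A).card : ℝ) - W.card| ≤
        10 * η * (9 / 10) ^ j * max (W.card : ℝ) (k / (2 * φ)) := by
  induction i generalizing j with
  | zero =>
    refine ⟨univ, fun k _ _ W _ => ?_⟩
    rw [inter_univ, pow_zero, one_mul, sub_self, abs_zero]
    positivity
  | succ i ih =>
    obtain ⟨A, hA⟩ := ih (j + 1) (by omega)
    have hpow : (9 / 10 : ℝ) ^ (j + 1) ≤ 1 := pow_le_one₀ (by norm_num) (by norm_num)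
    have hpow0 : (0 : ℝ) < (9 / 10) ^ (j + 1) := by positivity
    have hcoef : 10 * η * (9 / 10) ^ (j + 1) ≤ 1 / 4 := by nlinarith
    have hs : (2 : ℝ) ^ s = 2 ^ i * 2 ^ (j + 1) := by rw [← pow_add]; congr 1; omega
    have hi0 : (0 : ℝ) < 2 ^ i := by positivity
    have hj1 : (1 : ℝ) ≤ 2 ^ (j + 1) := one_le_pow₀ (by norm_num)
    have hAcard : |2 ^ i * (A.card : ℝ) - n| ≤ 1 / 4 * n := by
      have h := hA 1 le_rfl hK univ huniv
      rw [univ_inter, card_univ, ← hn, Nat.cast_one, max_eq_left] at h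
      · refine h.trans ?_
        gcongr
        rw [hnM]; positivity
      · rw [div_le_iff₀ (by positivity)]
        linarith
    rw [hnM, hs, abs_le] at hAcard
    have hAu : (A.card : ℝ) ≤ 5 / 4 * (2 ^ (j + 1) * M) := by
      refine le_of_mul_le_mul_left ?_ hi0
      linarith
    have hAl : 3 / 4 * (2 ^ (j + 1) * M) ≤ (A.card : ℝ) := by
      refine le_of_mul_le_mul_left ?_ hi0
      linarith
    have hA3 : (3 : ℝ) ≤ A.card := by nlinarith
    have hA2 : 2 ≤ A.card := by
      have : (2 : ℝ) ≤ A.card := by linarith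
      exact_mod_cast this
    have hlog1 : 1 ≤ Real.log (2 * M) := by
      rw [Real.le_log_iff_exp_le (by linarith)]
      linarith [Real.exp_one_lt_d9]
    have hlogA : Real.log A.card ≤ Real.log (2 * M) * (2 * (81 / 50) ^ (j + 1)) := by
      calc Real.log A.card ≤ Real.log (2 * M * 2 ^ (j + 1)) :=
            Real.log_le_log (by linarith) (by nlinarith)
        _ = Real.log (2 * M) + (j + 1 : ℕ) * Real.log 2 := by
            rw [Real.log_mul (by linarith) (by positivity), Real.log_pow]
        _ ≤ Real.log (2 * M) * (1 + (j + 1 : ℕ)) := by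
            have h2 : Real.log 2 ≤ Real.log (2 * M) := by linarith [Real.log_two_lt_d9]
            have h3 : (0 : ℝ) ≤ (j + 1 : ℕ) := Nat.cast_nonneg _
            nlinarith
        _ ≤ _ := by
            gcongr
            exact one_add_le_two_mul_pow (j + 1)
    obtain ⟨B, -, hB⟩ := exists_halving 𝓕 A K hA2 (h𝓕 A hA2)
    refine ⟨B, fun k hk1 hkK W hW => ?_⟩
    have h1 := hA k hk1 hkK W hW
    have h2 := hB k hk1 hkK W hW
    set x : ℝ := ((W ∩ A).card : ℝ)
    set y : ℝ := ((W ∩ B).card : ℝ)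
    set w : ℝ := (W.card : ℝ)
    set X := max w (k / (2 * φ))
    have hX0 : 0 ≤ X := (Nat.cast_nonneg _).trans (le_max_left _ _)
    have hx : 2 ^ i * x ≤ 2 * X := by
      have := (abs_le.1 h1).2
      have := le_max_left w (k / (2 * φ))
      nlinarith
    have hkX : (k : ℝ) ≤ 2 * φ * X := by
      have := le_max_right w (k / (2 * φ))
      rwa [div_le_iff₀ (by positivity), mul_comm] at this
    have hx0 : 0 ≤ x := Nat.cast_nonneg _
    have hdev : (2 ^ i * (2 * y - x)) ^ 2 ≤ (η * (9 / 10) ^ (j + 1) * X) ^ 2 := by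
      calc (2 ^ i * (2 * y - x)) ^ 2 = 2 ^ i * (2 ^ i * (2 * y - x) ^ 2) := by ring
        _ ≤ 2 ^ i * (2 ^ i * (32 * x * k * Real.log A.card)) := by gcongr
        _ = 32 * 2 ^ i * (2 ^ i * x) * k * Real.log A.card := by ring
        _ ≤ 32 * 2 ^ i * (2 * X) * (2 * φ * X) *
            (Real.log (2 * M) * (2 * (81 / 50) ^ (j + 1))) := by
          have : 0 ≤ Real.log A.card := Real.log_nonneg (by linarith)
          gcongr
        _ = 256 * (2 ^ i * 2 ^ (j + 1)) * φ * Real.log (2 * M) * ((81 / 100) ^ (j + 1) * X ^ 2) := by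
          rw [show (81 / 50 : ℝ) = 2 * (81 / 100) by norm_num, mul_pow]
          ring
        _ ≤ η ^ 2 * ((81 / 100) ^ (j + 1) * X ^ 2) := by
          rw [← hs]
          gcongr
        _ = _ := by
          rw [show (81 / 100 : ℝ) = (9 / 10) ^ 2 by norm_num, ← pow_mul]
          ring
    have habs := abs_le_of_sq_le_sq hdev (by positivity)
    calc |2 ^ (i + 1) * y - w| = |2 ^ i * (2 * y - x) + (2 ^ i * x - w)| := by
          congr 1; ring
      _ ≤ η * (9 / 10) ^ (j + 1) * X + 10 * η * (9 / 10) ^ (j + 1) * X :=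
          (abs_add_le _ _).trans (add_le_add habs h1)
      _ = 99 / 10 * (η * (9 / 10) ^ j * X) := by ring
      _ ≤ 10 * (η * (9 / 10) ^ j * X) := by gcongr; norm_num
      _ = _ := by ring

lemma mul_log_le {q L M : ℝ} (hq : 1 ≤ q) (hL : 1 ≤ L) (hqL : Real.log q ≤ L)
    (hM : 2 ^ 25 * (q * L) ≤ M) (hM' : M ≤ 2 ^ 26 * (q * L)) :
    409600 * q * Real.log (2 * M) ≤ M := by
  have hqL1 : 1 ≤ q * L := one_le_mul_of_one_le_of_one_le hq hL
  have hlog : Real.log (2 * M) ≤ 21 * L := by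
    calc Real.log (2 * M) ≤ Real.log (2 ^ 27 * (q * L)) :=
          Real.log_le_log (by linarith) (by linarith)
      _ = 27 * Real.log 2 + (Real.log q + Real.log L) := by
          rw [Real.log_mul (by norm_num) (by positivity), Real.log_pow,
            Real.log_mul (by positivity) (by positivity)]
          norm_num
      _ ≤ 21 * L := by
          have := Real.log_two_lt_d9
          have := Real.log_le_sub_one_of_pos (by linarith : 0 < L)
          linarith
  calc 409600 * q * Real.log (2 * M) ≤ 409600 * q * (21 * L) := by gcongr
    _ ≤ 2 ^ 25 * (q * L) := by nlinarith
    _ ≤ M := hM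

lemma abs_rescaled_sub_le {n t z w y X ε : ℝ} (hn : 0 < n) (hε : 0 < ε) (hε1 : ε < 1) (hy : 0 < y)
    (hw : 0 ≤ w) (hwX : w ≤ X) (ht : |y * t - n| ≤ ε / 4 * n) (hz : |y * z - w| ≤ ε / 4 * X) :
    |n / t * z - w| ≤ ε * X := by
  have hyt : 3 / 4 * n ≤ y * t := by nlinarith [(abs_le.1 ht).1]
  have ht0 : 0 < t := by
    refine pos_of_mul_pos_right (a := y) ?_ hy.le
    linarith
  have hX : 0 ≤ X := hw.trans hwX
  have h1 : |y * t * (n / t * z - w)| ≤ ε / 2 * n * X := by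
    have e : y * t * (n / t * z - w) = n * (y * z - w) - w * (y * t - n) := by
      field_simp
      ring
    rw [e]
    calc |n * (y * z - w) - w * (y * t - n)| ≤ |n * (y * z - w)| + |w * (y * t - n)| :=
          abs_sub _ _
      _ ≤ n * (ε / 4 * X) + X * (ε / 4 * n) := by
          rw [abs_mul, abs_mul, abs_of_pos hn, abs_of_nonneg hw]
          gcongr
      _ = _ := by ring
  rw [abs_mul, abs_of_pos (by positivity)] at h1
  have h2 : 3 / 4 * n * |n / t * z - w| ≤ 3 / 4 * n * (ε * X) := by
    calc _ ≤ y * t * |n / t * z - w| := by gcongr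
      _ ≤ ε / 2 * n * X := h1
      _ ≤ _ := by
        have : 0 ≤ n * ε * X := by positivity
        linarith
  exact le_of_mul_le_mul_left h2 (by positivity)

end Iteration

section Main

variable {V : Type*} [Fintype V]

lemma vNbr_nonempty {G : SimpleGraph V} (hG : G.Connected) {W : Finset V} (hW : W.Nonempty)
    (hW' : (univ \ (W ∪ vNbr G W)).Nonempty) : (vNbr G W).Nonempty := by
  obtain ⟨a, ha⟩ := hW
  obtain ⟨b, hb⟩ := hW'
  by_contra hne
  rw [not_nonempty_iff_eq_empty] at hne
  have hclosed : ∀ x ∈ W, ∀ y, G.Adj x y → y ∈ W := by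
    intro x hx y hxy
    by_contra hy
    have : y ∈ vNbr G W := mem_vNbr.2 ⟨hy, x, hx, hxy⟩
    simp [hne] at this
  have key : ∀ x y, G.Walk x y → x ∈ W → y ∈ W := by
    intro x y q
    induction q with
    | nil => exact id
    | cons h _ ih => exact fun hx => ih (hclosed _ hx _ h)
  obtain ⟨q⟩ := hG.preconnected a b
  simp [key a b q ha] at hb

lemma univ_mem_cutFamily {G : SimpleGraph V} (hG : G.Connected) (k : ℕ) :
    univ ∈ cutFamily G k := by
  have hempty : vNbr G univ = ∅ := by ext; simp [mem_vNbr]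
  have hconn : (G.induce ((univ : Finset V) : Set V)).Connected := by
    rw [coe_univ]
    exact (SimpleGraph.induceUnivIso G).connected_iff.2 hG
  simp only [cutFamily, mem_filter, mem_univ, true_and, hempty, card_empty, zero_le]
  exact Or.inl fun a _ => isConnectedFrom_of_induce_connected hconn (mem_univ a)

lemma mem_cutFamily_of_connected {G : SimpleGraph V} {W : Finset V}
    (h : (G.induce (W : Set V)).Connected ∨
      (G.induce ((univ \ (W ∪ vNbr G W) : Finset V) : Set V)).Connected) :
    W ∈ cutFamily G (vNbr G W).card := by
  simp only [cutFamily, mem_filter, mem_univ, true_and, le_refl]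
  exact h.imp (fun h _ ha => isConnectedFrom_of_induce_connected h ha)
    fun h _ ha => isConnectedFrom_of_induce_connected h ha

/-- A cut which is sparse, or sparse with respect to the terminals, has a large side. -/
lemma le_card_of_sparse {n t z w k r φ ε X : ℝ} (hn : 0 < n) (hk : 0 < k) (hφ : 0 < φ)
    (hφ' : φ < 1 / 2) (hε : ε < 1) (ht : n * φ ≤ t) (hr : r ≤ k)
    (hX : X = max w (k / (2 * φ))) (hz : |n / t * z - w| ≤ ε * X)
    (h : k ≤ φ * (w + k) ∨ k ≤ n / (10 * t) * φ * (z + r)) : k / (2 * φ) ≤ w := by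
  rcases h with h | h
  · rw [div_le_iff₀ (by positivity)]
    nlinarith
  · by_contra! hlt
    rw [hX, max_eq_right hlt.le] at hz
    have hz' := (abs_le.1 hz).2
    have hk0 : 0 < k / (2 * φ) := by positivity
    have h1 : n / t * z ≤ k / φ := by
      have e : k / φ = 2 * (k / (2 * φ)) := by field_simp
      rw [e]
      nlinarith
    have ht0 : 0 < t := lt_of_lt_of_le (by positivity) ht
    have h2 : n / (10 * t) * φ * (z + r) = φ / 10 * (n / t * z) + n * φ / t * r / 10 := by
      field_simp
    have h3 : φ / 10 * (n / t * z) ≤ k / 10 := by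
      calc _ ≤ φ / 10 * (k / φ) := by gcongr
        _ = k / 10 := by field_simp
    have h4 : n * φ / t * r ≤ k := by
      calc n * φ / t * r ≤ n * φ / t * k := by gcongr
        _ ≤ 1 * k := by
          gcongr
          rwa [div_le_one ht0]
        _ = k := one_mul k
    linarith

lemma card_vNbr_union (G : SimpleGraph V) (W : Finset V) :
    (W ∪ vNbr G W).card = W.card + (vNbr G W).card :=
  card_union_of_disjoint (Finset.disjoint_left.2 fun _ h h' => (mem_vNbr.1 h').1 h)

lemma card_vNbr_union_inter (G : SimpleGraph V) (W T : Finset V) :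
    ((W ∪ vNbr G W) ∩ T).card = (W ∩ T).card + (vNbr G W ∩ T).card := by
  rw [union_inter_distrib_right]
  exact card_union_of_disjoint (Finset.disjoint_left.2 fun _ h h' =>
    (mem_vNbr.1 (mem_inter.1 h').1).1 (mem_inter.1 h).1)

/-- Sample sets of size proportional to `M = n / 2 ^ s`. -/
lemma exists_sample {G : SimpleGraph V} (hG : G.Connected) {n φ ε M : ℝ} {s : ℕ}
    (hn : n = Fintype.card V) (hφ : 0 < φ) (hφ' : φ < 1 / 2) (hnφ : 1 ≤ n * φ)
    (hε : 0 < ε) (hε' : ε < 1) (hM : 4 ≤ M) (hnM : n = 2 ^ s * M) (hφM : 2 * (n * φ) ≤ M)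
    (hlog : 409600 * (n * φ / ε ^ 2) * Real.log (2 * M) ≤ M) :
    ∃ T : Finset V, T.Nonempty ∧ (T.card : ℝ) ≤ 2 * M ∧
      ∀ W : Finset V, W.Nonempty → (univ \ (W ∪ vNbr G W)).Nonempty →
        ((G.induce (W : Set V)).Connected ∨
          (G.induce ((univ \ (W ∪ vNbr G W) : Finset V) : Set V)).Connected) →
        (((vNbr G W).card : ℝ) ≤ φ * ((W ∪ vNbr G W).card : ℝ) ∨
          ((vNbr G W).card : ℝ) ≤ (n / (10 * (T.card : ℝ))) * φ *
            (((W ∪ vNbr G W) ∩ T).card : ℝ)) →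
        |(n / (T.card : ℝ)) * ((W ∩ T).card : ℝ) - (W.card : ℝ)| ≤ ε * (W.card : ℝ) := by
  have hn0 : 0 < n := by rw [hnM]; positivity
  have hcard1 : 1 ≤ Fintype.card V := by
    rw [hn] at hn0
    exact_mod_cast hn0
  have hlog' : 256 * 2 ^ s * φ * Real.log (2 * M) ≤ (ε / 40) ^ 2 := by
    have h1 : 409600 * (n * φ / ε ^ 2) * Real.log (2 * M) =
        256 * 2 ^ s * φ * Real.log (2 * M) * (1600 / ε ^ 2) * M := by
      rw [hnM]; ring
    rw [h1] at hlog
    have h2 : 256 * 2 ^ s * φ * Real.log (2 * M) * (1600 / ε ^ 2) ≤ 1 :=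
      le_of_mul_le_mul_right (by rwa [one_mul]) (by linarith : 0 < M)
    rw [← mul_div_assoc, div_le_one (by positivity)] at h2
    linarith
  obtain ⟨T, hT⟩ := exists_iterated_halving (cutFamily G)
    (fun A hA k hk => card_traces_cutFamily_le G A hk hA) (univ_mem_cutFamily hG 1) hcard1 hn hφ hnφ
    (by positivity : 0 < ε / 40) (by linarith) hM hnM hlog' s 0 (add_zero s)
  have hε4 : 10 * (ε / 40) * (9 / 10) ^ 0 = ε / 4 := by ring
  rw [hε4] at hT
  have hTcard : |2 ^ s * (T.card : ℝ) - n| ≤ ε / 4 * n := by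
    have h := hT 1 le_rfl hcard1 univ (univ_mem_cutFamily hG 1)
    rwa [univ_inter, card_univ, ← hn, Nat.cast_one, max_eq_left] at h
    rw [div_le_iff₀ (by positivity)]
    linarith
  have hs0 : (0 : ℝ) < 2 ^ s := by positivity
  have hTl : M / 2 ≤ T.card := by
    refine le_of_mul_le_mul_left ?_ hs0
    have := (abs_le.1 hTcard).1
    nlinarith
  have hTu : (T.card : ℝ) ≤ 2 * M := by
    refine le_of_mul_le_mul_left ?_ hs0
    have := (abs_le.1 hTcard).2
    nlinarith
  refine ⟨T, ?_, hTu, fun W hW hW' hconn hsparse => ?_⟩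
  · rw [← card_pos]
    have : (0 : ℝ) < T.card := by linarith
    exact_mod_cast this
  have hk := card_pos.2 (vNbr_nonempty hG hW hW')
  have hdev := hT _ hk (card_le_univ _) W (mem_cutFamily_of_connected hconn)
  have hmain := abs_rescaled_sub_le hn0 hε hε' hs0 (Nat.cast_nonneg _) (le_max_left _ _) hTcard hdev
  have hr : ((vNbr G W ∩ T).card : ℝ) ≤ (vNbr G W).card := by
    exact_mod_cast card_le_card inter_subset_left
  rw [card_vNbr_union, card_vNbr_union_inter, Nat.cast_add, Nat.cast_add] at hsparse
  have hlarge := le_card_of_sparse hn0 (by exact_mod_cast hk) hφ hφ' hε' (by linarith) hr rfl hmain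
    hsparse
  rwa [max_eq_left hlarge] at hmain

end Main

/-- Existence of vertex sample sets for sparse vertex cuts. -/
theorem vertex_sample_sets :
    ∃ c : ℝ, 1 ≤ c ∧
      ∀ (V : Type) [Fintype V] (G : SimpleGraph V) (n : ℕ),
        n = Fintype.card V → G.Connected → 1 ≤ n →
        ∀ ε φ' : ℝ, 0 < ε → ε < 1 → 0 < φ' → φ' < 1 / 2 →
          ∃ T : Finset V, T.Nonempty ∧
            (T.card : ℝ) ≤ min (n : ℝ)
              ((⌈c * ((n : ℝ) * φ' / ε ^ 2) * Real.log (2 + (n : ℝ) * φ' / ε ^ 3)⌉ : ℤ) : ℝ) ∧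
            ∀ W : Finset V, W.Nonempty →
              (Finset.univ \ (W ∪ vNbr G W)).Nonempty →
              ((G.induce (W : Set V)).Connected ∨
                (G.induce ((Finset.univ \ (W ∪ vNbr G W) : Finset V) : Set V)).Connected) →
              (((vNbr G W).card : ℝ) ≤ φ' * ((W ∪ vNbr G W).card : ℝ) ∨
                ((vNbr G W).card : ℝ) ≤ ((n : ℝ) / (10 * (T.card : ℝ))) * φ' *
                  (((W ∪ vNbr G W) ∩ T).card : ℝ)) →
              |((n : ℝ) / (T.card : ℝ)) * ((W ∩ T).card : ℝ) - (W.card : ℝ)| ≤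
                ε * (W.card : ℝ) := by
  refine ⟨2 ^ 27, by norm_num, fun V _ G n hn hG hn1 ε φ hε hε' hφ hφ' => ?_⟩
  have hn0 : (0 : ℝ) < n := by exact_mod_cast hn1
  set q := (n : ℝ) * φ / ε ^ 2 with hq
  set L := Real.log (2 + (n : ℝ) * φ / ε ^ 3) with hL
  have hq0 : 0 < q := by positivity
  have hL0 : 0 < L := Real.log_pos (by
    have : 0 < (n : ℝ) * φ / ε ^ 3 := by positivity
    linarith)
  have hceil := Int.le_ceil (2 ^ 27 * q * L)
  obtain ⟨v⟩ : Nonempty V := hG.nonempty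
  rcases lt_or_ge ((n : ℝ) * φ) 1 with hsmall | hnφ
  · refine ⟨{v}, singleton_nonempty v, ?_, fun W hW hW' _ hsparse => ?_⟩
    · rw [card_singleton, Nat.cast_one, le_min_iff]
      refine ⟨by exact_mod_cast hn1, ?_⟩
      have : 0 < ⌈2 ^ 27 * q * L⌉ := Int.ceil_pos.2 (by positivity)
      exact_mod_cast this
    · exfalso
      have hk : (1 : ℝ) ≤ (vNbr G W).card := by
        exact_mod_cast card_pos.2 (vNbr_nonempty hG hW hW')
      rcases hsparse with h | h
      · have h1 : ((W ∪ vNbr G W).card : ℝ) ≤ n := by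
          rw [hn]
          exact_mod_cast card_le_univ _
        nlinarith
      · have h1 : (((W ∪ vNbr G W) ∩ {v}).card : ℝ) ≤ 1 := by
          have := card_le_card (inter_subset_right : (W ∪ vNbr G W) ∩ {v} ⊆ {v})
          rw [card_singleton] at this
          exact_mod_cast this
        rw [card_singleton, Nat.cast_one] at h
        have h2 : (n : ℝ) / (10 * 1) * φ * (((W ∪ vNbr G W) ∩ {v}).card : ℝ) ≤
            (n : ℝ) / (10 * 1) * φ * 1 := by gcongr
        linarith
  rcases le_or_gt (n : ℝ) (2 ^ 27 * q * L) with hlarge | hlt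
  · refine ⟨univ, ⟨v, mem_univ v⟩, ?_, fun W _ _ _ _ => ?_⟩
    · rw [card_univ, ← hn]
      exact le_min le_rfl (hlarge.trans hceil)
    · rw [card_univ, ← hn, div_self hn0.ne', inter_univ, one_mul, sub_self, abs_zero]
      positivity
  have hnq : (n : ℝ) * φ ≤ q := by
    rw [hq, le_div_iff₀ (by positivity)]
    have : ε ^ 2 ≤ 1 := pow_le_one₀ hε.le hε'.le
    nlinarith
  have hq1 : 1 ≤ q := hnφ.trans hnq
  have hq3 : q ≤ (n : ℝ) * φ / ε ^ 3 :=
    div_le_div_of_nonneg_left (by positivity) (by positivity)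
      (pow_le_pow_of_le_one hε.le hε'.le (by norm_num))
  have hL1 : 1 ≤ L := by
    rw [hL, Real.le_log_iff_exp_le (by linarith)]
    linarith [Real.exp_one_lt_d9]
  have hqL : Real.log q ≤ L := Real.log_le_log hq0 (by linarith)
  have hqL1 : 1 ≤ q * L := one_le_mul_of_one_le_of_one_le hq1 hL1
  obtain ⟨s, hs, hs'⟩ := exists_nat_pow_near (x := (n : ℝ) / (2 ^ 25 * (q * L))) (y := 2)
    ((one_le_div (by positivity)).2 (by linarith)) (by norm_num)
  rw [le_div_iff₀ (by positivity)] at hs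
  rw [div_lt_iff₀ (by positivity), pow_succ] at hs'
  have hs0 : (0 : ℝ) < 2 ^ s := by positivity
  obtain ⟨M, hnM⟩ : ∃ M : ℝ, (n : ℝ) = 2 ^ s * M := ⟨n / 2 ^ s, by field_simp⟩
  rw [hnM] at hs hs'
  have hMl : 2 ^ 25 * (q * L) ≤ M := le_of_mul_le_mul_left hs hs0
  have hMu : M ≤ 2 ^ 26 * (q * L) := by
    refine le_of_mul_le_mul_left ?_ hs0
    linarith
  have hqqL : q ≤ q * L := le_mul_of_one_le_right hq0.le hL1
  obtain ⟨T, hT, hTM, hsample⟩ := exists_sample hG (by rw [hn]) hφ hφ' hnφ hε hε'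
    (by linarith) hnM (by linarith) (mul_log_le hq1 hL1 hqL hMl hMu)
  refine ⟨T, hT, le_min ?_ ?_, hsample⟩
  · rw [hn]
    exact_mod_cast card_le_univ T
  · refine le_trans ?_ hceil
    linarith
end

section
/- Balanced low-conductance cut dichotomy. Let H be a Δ-regular finite simple graph on n ≥ 1 vertices with Δ ≥ 1, let b ∈ (0, 1/2), and let ψ > 0. Then at least one of the following holds: (1) there exists W ⊆ V(H) with min(|W|, |V(H)∖W|) ≥ (b/4)·n and |δ_H(W)| ≤ ψ·Δ·min(|W|, |V(H)∖W|); or (2) there exists Y' ⊆ V(H) with |Y'| ≤ (b/4)·n such that every nonempty Z ⊆ V(H) with |Z| ≤ n/2 and |δ_H(Z)| ≤ (ψ/3)·Δ·|Z| satisfies |Y' ∩ Z| ≥ (3/5)·|Z|. -/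
open Finset

attribute [local instance] Classical.propDecidable

theorem cutSize_empty {V : Type*} (G : SimpleGraph V) : cutSize G ∅ = 0 := by
  simp [cutSize]

/-- The cut size is subadditive under unions. -/
theorem cutSize_union_le {V : Type*} [Finite V] (G : SimpleGraph V) (A B : Finset V) :
    cutSize G (A ∪ B) ≤ cutSize G A + cutSize G B := by
  refine (Set.ncard_le_ncard ?_ (Set.toFinite _)).trans (Set.ncard_union_le _ _)
  rintro e ⟨he, ⟨u, hue, hu⟩, v, hve, hv⟩
  obtain ⟨hvA, hvB⟩ := notMem_union.mp hv
  rcases mem_union.mp hu with hu | hu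
  · exact Or.inl ⟨he, ⟨u, hue, hu⟩, v, hve, hvA⟩
  · exact Or.inr ⟨he, ⟨u, hue, hu⟩, v, hve, hvB⟩

/-- Balanced low-conductance cut dichotomy. -/
theorem balanced_low_conductance_dichotomy {V : Type*} [Fintype V] (H : SimpleGraph V)
    (n Δ : ℕ) (hn : n = Fintype.card V) (hn1 : 1 ≤ n) (hΔ : 1 ≤ Δ)
    (hreg : H.IsRegularOfDegree Δ) (b ψ : ℝ) (hb0 : 0 < b) (hb : b < 1 / 2) (hψ : 0 < ψ) :
    (∃ W : Finset V,
        (b / 4) * (n : ℝ) ≤ min (W.card : ℝ) ((Wᶜ).card : ℝ) ∧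
        (cutSize H W : ℝ) ≤ ψ * (Δ : ℝ) * min (W.card : ℝ) ((Wᶜ).card : ℝ)) ∨
    (∃ Y' : Finset V, (Y'.card : ℝ) ≤ (b / 4) * (n : ℝ) ∧
        ∀ Z : Finset V, Z.Nonempty → (Z.card : ℝ) ≤ (n : ℝ) / 2 →
          (cutSize H Z : ℝ) ≤ (ψ / 3) * (Δ : ℝ) * (Z.card : ℝ) →
          (3 / 5 : ℝ) * (Z.card : ℝ) ≤ ((Y' ∩ Z).card : ℝ)) := by
  have hcompl (W : Finset V) : (W.card : ℝ) + (Wᶜ.card : ℝ) = n := by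
    rw [hn]; exact_mod_cast card_add_card_compl W
  have hn0 : (0 : ℝ) < n := by exact_mod_cast hn1
  have hψΔ : 0 < ψ * (Δ : ℝ) := mul_pos hψ (by exact_mod_cast hΔ)
  have hbn : b * n < 1 / 2 * n := mul_lt_mul_of_pos_right hb hn0
  rw [or_iff_not_imp_left]
  intro hno
  have hbal (W : Finset V) (hlow : (b / 4) * n ≤ W.card) (hhalf : (W.card : ℝ) ≤ n / 2) :
      ψ * Δ * W.card < cutSize H W := by
    by_contra! hcut
    have hmin : min (W.card : ℝ) (Wᶜ.card : ℝ) = W.card :=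
      min_eq_left (by linarith [hcompl W])
    exact hno ⟨W, by rwa [hmin], by rwa [hmin]⟩
  let S : Finset (Finset V) :=
    {Y | (Y.card : ℝ) ≤ (b / 4) * n ∧ (cutSize H Y : ℝ) ≤ ψ * Δ * Y.card}
  have hS : S.Nonempty :=
    ⟨∅, by
      simp only [S, mem_filter, mem_univ, true_and, cutSize_empty, card_empty, Nat.cast_zero,
        mul_zero, le_refl, and_true]
      positivity⟩
  obtain ⟨Y, hYS, hmax⟩ := S.exists_max_image card hS
  obtain ⟨hYcard, hYcut⟩ : (Y.card : ℝ) ≤ (b / 4) * n ∧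
      (cutSize H Y : ℝ) ≤ ψ * Δ * Y.card := by simpa [S] using hYS
  refine ⟨Y, hYcard, fun Z hZ hZhalf hZcut => ?_⟩
  by_contra! hinter
  have hZpos : (0 : ℝ) < Z.card := by exact_mod_cast hZ.card_pos
  have hprod := mul_pos hψΔ hZpos
  have hZsmall : (Z.card : ℝ) < (b / 4) * n := by
    by_contra! hlow
    linarith [hbal Z hlow hZhalf]
  have hunion : ((Y ∪ Z).card : ℝ) + ((Y ∩ Z).card : ℝ) = Y.card + Z.card := by
    exact_mod_cast card_union_add_card_inter Y Z
  have hsub : (cutSize H (Y ∪ Z) : ℝ) ≤ cutSize H Y + cutSize H Z := by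
    exact_mod_cast cutSize_union_le H Y Z
  have hcut : (cutSize H (Y ∪ Z) : ℝ) ≤ ψ * Δ * (Y ∪ Z).card := by
    have hgrow : (Y.card : ℝ) + Z.card / 3 ≤ (Y ∪ Z).card := by linarith
    linarith [mul_le_mul_of_nonneg_left hgrow hψΔ.le]
  rcases le_total ((Y ∪ Z).card : ℝ) ((b / 4) * n) with hle | hge
  · have hcard : ((Y ∪ Z).card : ℝ) ≤ Y.card := by
      exact_mod_cast hmax (Y ∪ Z) (by simpa [S] using And.intro hle hcut)
    linarith
  · have hinter_nonneg : (0 : ℝ) ≤ (Y ∩ Z).card := Nat.cast_nonneg _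
    linarith [hbal (Y ∪ Z) hge (by linarith)]
end

section
/- Soundness of the ImproveCut procedure (existence form). Let ρ ≥ 200 be a real number, let H be a finite simple graph on n ≥ 1 vertices, and let W ⊆ V(H) be a set with |δ_H(W)| ≤ n/(100·ρ³). Then there exists a set Q ⊆ W with |Q| ≥ |W| − n/(100·ρ) such that for every S ⊆ V(H) with |δ_H(S)| ≤ |S|/ρ^{101}, the number of edges of H having both endpoints in S and exactly one endpoint in Q is at most |S|/(100·ρ). -/
open Finset

attribute [local instance] Classical.propDecidable

/-- The number of edges of `G` having both endpoints in `S` and exactly one endpoint in `Q`,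
i.e. the edges of `G[S]` cut by `Q`. -/
noncomputable def cutInside {V : Type*} (G : SimpleGraph V) (S Q : Finset V) : ℕ :=
  {e : Sym2 V | e ∈ G.edgeSet ∧ (∀ u ∈ e, u ∈ S) ∧
    (∃ u ∈ e, u ∈ Q) ∧ (∃ v ∈ e, v ∉ Q)}.ncard

/-- Removing `S` from `Q` uncuts the edges inside `S` and only cuts edges of `δ(S)`. -/
theorem cutSize_sdiff_add_cutInside_le {V : Type*} [Finite V] (G : SimpleGraph V)
    (Q S : Finset V) :
    cutSize G (Q \ S) + cutInside G S Q ≤ cutSize G Q + cutSize G S := by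
  unfold cutSize cutInside
  rw [← Set.ncard_union_eq ?_ (Set.toFinite _) (Set.toFinite _)]
  · refine (Set.ncard_le_ncard ?_ (Set.toFinite _)).trans (Set.ncard_union_le _ _)
    rintro e (⟨he, ⟨u, hu, huQ⟩, v, hv, hvQ⟩ | ⟨he, -, hu, hv⟩)
    · simp only [mem_sdiff, not_and, not_not] at huQ hvQ
      by_cases hvQ' : v ∈ Q
      · exact Or.inr ⟨he, ⟨v, hv, hvQ hvQ'⟩, u, hu, huQ.2⟩
      · exact Or.inl ⟨he, ⟨u, hu, huQ.1⟩, v, hv, hvQ'⟩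
    · exact Or.inl ⟨he, hu, hv⟩
  · refine Set.disjoint_left.2 ?_
    rintro e ⟨-, ⟨u, hu, huQ⟩, -⟩ ⟨-, hS, -⟩
    exact (mem_sdiff.1 huQ).2 (hS u hu)

/-- Soundness of the ImproveCut procedure (existence form). -/
theorem improveCut_sound {V : Type*} [Fintype V] (H : SimpleGraph V) (n : ℕ)
    (hn : n = Fintype.card V) (hn1 : 1 ≤ n) (ρ : ℝ) (hρ : 200 ≤ ρ) (W : Finset V)
    (hW : (cutSize H W : ℝ) ≤ (n : ℝ) / (100 * ρ ^ 3)) :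
    ∃ Q ⊆ W, (W.card : ℝ) - (n : ℝ) / (100 * ρ) ≤ (Q.card : ℝ) ∧
      ∀ S : Finset V, (cutSize H S : ℝ) ≤ (S.card : ℝ) / ρ ^ 101 →
        (cutInside H S Q : ℝ) ≤ (S.card : ℝ) / (100 * ρ) := by
  have hρ0 : 0 < ρ := by linarith
  obtain ⟨Q, hQ, hmin⟩ := W.powerset.exists_min_image
    (fun Q => (cutSize H Q : ℝ) - (Q.card : ℝ) / ρ ^ 2) ⟨W, mem_powerset_self W⟩
  have hQW := mem_powerset.1 hQ
  refine ⟨Q, hQW, ?_, fun S hS => ?_⟩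
  · have hWQ := hmin W (mem_powerset_self W)
    have hpos : (0 : ℝ) ≤ cutSize H Q := Nat.cast_nonneg _
    have hle : ((W.card : ℝ) - Q.card) / ρ ^ 2 ≤ (n : ℝ) / (100 * ρ ^ 3) := by
      rw [sub_div]; linarith
    rw [div_le_iff₀ (by positivity)] at hle
    have heq : (n : ℝ) / (100 * ρ ^ 3) * ρ ^ 2 = n / (100 * ρ) := by
      field_simp
    linarith
  · have hQS := hmin (Q \ S) (mem_powerset.2 (sdiff_subset.trans hQW))
    have hcut : ((cutSize H (Q \ S) : ℕ) : ℝ) + cutInside H S Q ≤ cutSize H Q + cutSize H S :=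
      mod_cast cutSize_sdiff_add_cutInside_le H Q S
    have hcard : (Q.card : ℝ) ≤ (Q \ S).card + S.card := by
      have := le_card_sdiff S Q
      exact_mod_cast (by omega : Q.card ≤ (Q \ S).card + S.card)
    have hdiv : (Q.card : ℝ) / ρ ^ 2 ≤ (Q \ S).card / ρ ^ 2 + S.card / ρ ^ 2 := by
      rw [← add_div]; gcongr
    have hpow : (S.card : ℝ) / ρ ^ 101 ≤ S.card / ρ ^ 3 := by
      gcongr
      · linarith
      · norm_num
    have hsq : (S.card : ℝ) / ρ ^ 2 ≤ S.card / (200 * ρ) := by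
      gcongr; nlinarith
    have hcube : (S.card : ℝ) / ρ ^ 3 ≤ S.card / (200 * ρ) := by
      gcongr; nlinarith [mul_pos hρ0 hρ0]
    have hsum : (S.card : ℝ) / (200 * ρ) + S.card / (200 * ρ) = S.card / (100 * ρ) := by
      field_simp; ring
    linarith
end

section
/- Ball-size bounds from LP spreading constraints. Let V be a finite set with |V| = n, let s, ℓ ≥ 0 and K ≥ 0 be real numbers, let x : V → ℝ≥0 with Σ_{u∈V} x(u) = K, let y > 0 be a real number, and let d : V → ℝ≥0. Suppose Σ_{u∈V} min(d(u), y) ≥ (n − s)·y and Σ_{u∈V} x(u)·min(d(u), y) ≥ (K − ℓ)·y. Then for every r ∈ [0,1), the set B_r = {u ∈ V : d(u) ≤ r·y} satisfies |B_r| ≤ s/(1 − r) and Σ_{u∈B_r} x(u) ≤ ℓ/(1 − r). -/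
open Finset

attribute [local instance] Classical.propDecidable

/-- Weighted form: if the truncated distances `min (d u) y` have `w`-weighted sum at least
`(∑ u, w u - t) * y`, then the ball of radius `r * y` has `w`-weight at most `t / (1 - r)`. -/
theorem sum_ball_le_of_spreading {V : Type*} [Fintype V] {w d : V → ℝ} {t y r : ℝ}
    (hw : ∀ u, 0 ≤ w u) (hy : 0 < y) (hr : r < 1)
    (h : (∑ u, w u - t) * y ≤ ∑ u, w u * min (d u) y) :
    ∑ u ∈ Finset.univ.filter (fun u => d u ≤ r * y), w u ≤ t / (1 - r) := by
  have key : ∑ u, w u * min (d u) y ≤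
      ∑ u, (w u * y - if d u ≤ r * y then w u * ((1 - r) * y) else 0) := by
    refine Finset.sum_le_sum fun u _ => ?_
    split_ifs with hu
    · have := mul_le_mul_of_nonneg_left ((min_le_left (d u) y).trans hu) (hw u)
      linarith
    · simpa using mul_le_mul_of_nonneg_left (min_le_right (d u) y) (hw u)
  rw [Finset.sum_sub_distrib, ← Finset.sum_filter, ← Finset.sum_mul, ← Finset.sum_mul] at key
  rw [le_div_iff₀ (sub_pos.2 hr)]
  refine le_of_mul_le_mul_right ?_ hy
  linarith

/-- Ball-size bounds from LP spreading constraints. -/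
theorem ball_bounds_from_spreading {V : Type*} [Fintype V] (n : ℕ)
    (hn : n = Fintype.card V) (s ℓ K : ℝ) (hs : 0 ≤ s) (hℓ : 0 ≤ ℓ) (hK : 0 ≤ K)
    (x : V → ℝ) (hx : ∀ v, 0 ≤ x v) (hxK : ∑ u, x u = K)
    (y : ℝ) (hy : 0 < y) (d : V → ℝ) (hd : ∀ v, 0 ≤ d v)
    (h1 : ((n : ℝ) - s) * y ≤ ∑ u, min (d u) y)
    (h2 : (K - ℓ) * y ≤ ∑ u, x u * min (d u) y) :
    ∀ r : ℝ, 0 ≤ r → r < 1 →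
      (((Finset.univ.filter (fun u => d u ≤ r * y)).card : ℝ) ≤ s / (1 - r) ∧
        ∑ u ∈ Finset.univ.filter (fun u => d u ≤ r * y), x u ≤ ℓ / (1 - r)) := by
  intro r _ hr
  refine ⟨?_, sum_ball_le_of_spreading hx hy hr (hxK ▸ h2)⟩
  simpa using sum_ball_le_of_spreading (w := fun _ => 1) (d := d) (t := s)
    (fun _ => zero_le_one) hy hr (by simpa [← hn] using h1)
end

section
/- Pigeonhole grouping of components by their neighbourhood in a small separator. Let G be a finite simple graph, let C ⊆ V(G) with |C| = k, and let L ⊆ V(G) ∖ C be a nonempty set such that no edge of G joins L to V(G) ∖ (L ∪ C) (i.e., L is a union of connected components of G − C). Then there exists a nonempty collection 𝒜 of connected components of the induced subgraph G[L] such that all components in 𝒜 have the same neighbourhood in C (N_G(A) is the same set for all A ∈ 𝒜) and the union of the components in 𝒜 has at least |L|/2^k vertices. -/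
open Finset

attribute [local instance] Classical.propDecidable

/-- `A` is a connected component of the induced subgraph `G[L]`: `A` is a nonempty subset
of `L`, `G[A]` is connected, and `A` is closed under adjacency within `L`. -/
def IsCompOf {V : Type*} (G : SimpleGraph V) (L A : Finset V) : Prop :=
  A ⊆ L ∧ A.Nonempty ∧ (G.induce (A : Set V)).Connected ∧
    ∀ u ∈ A, ∀ v ∈ L, G.Adj u v → v ∈ A

/-- Every vertex of `L` lies in a connected component of `G[L]`. -/
lemma exists_isCompOf_mem {V : Type*} (G : SimpleGraph V) {L : Finset V} {v : V} (hv : v ∈ L) :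
    ∃ A, IsCompOf G L A ∧ v ∈ A := by
  obtain ⟨A, hA, hmax⟩ := Finset.exists_max_image
    (L.powerset.filter fun A : Finset V => v ∈ A ∧ (G.induce (A : Set V)).Connected) Finset.card
    ⟨{v}, by simp [hv, SimpleGraph.connected_iff, SimpleGraph.Preconnected.of_subsingleton]⟩
  simp only [mem_filter, mem_powerset] at hA hmax
  obtain ⟨hAL, hvA, hconn⟩ := hA
  refine ⟨A, ⟨hAL, ⟨v, hvA⟩, hconn, fun u hu w hw huw => ?_⟩, hvA⟩
  by_contra hwA
  have hle := hmax (insert w A) ⟨insert_subset hw hAL, mem_insert_of_mem hvA, by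
    have h := SimpleGraph.induce_union_connected hconn.preconnected
      (SimpleGraph.induce_pair_connected_of_adj huw).preconnected ⟨u, hu, Set.mem_insert u {w}⟩
    rwa [Set.union_insert, Set.union_singleton,
      Set.insert_eq_of_mem (Set.mem_insert_of_mem w (mem_coe.mpr hu)), ← coe_insert] at h⟩
  rw [card_insert_of_notMem hwA] at hle
  omega

/-- If no edge joins `L` to the outside of `L ∪ C`, then components of `G[L]` have their
neighbourhood inside `C`. -/
lemma IsCompOf.vNbr_subset {V : Type*} [Fintype V] {G : SimpleGraph V} {L A C : Finset V}
    (hA : IsCompOf G L A) (hsep : ∀ u ∈ L, ∀ v, v ∉ L → v ∉ C → ¬ G.Adj u v) :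
    vNbr G A ⊆ C := by
  intro v hv
  obtain ⟨hvA, u, hu, huv⟩ := (mem_filter.mp hv).2
  by_contra hvC
  exact hsep u (hA.1 hu) v (fun hvL => hvA (hA.2.2.2 u hu v hvL huv)) hvC huv

/-- Pigeonhole grouping of components by their neighbourhood in a small separator. -/
theorem component_grouping {V : Type} [Fintype V] (G : SimpleGraph V) (C L : Finset V)
    (k : ℕ) (hC : C.card = k) (hdisj : Disjoint L C) (hL : L.Nonempty)
    (hsep : ∀ u ∈ L, ∀ v, v ∉ L → v ∉ C → ¬ G.Adj u v) :
    ∃ 𝒜 : Finset (Finset V), 𝒜.Nonempty ∧ (∀ A ∈ 𝒜, IsCompOf G L A) ∧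
      (∃ D : Finset V, ∀ A ∈ 𝒜, vNbr G A = D) ∧
      (L.card : ℝ) / 2 ^ k ≤ ((𝒜.biUnion id).card : ℝ) := by
  choose! f hf hmem using fun v (hv : v ∈ L) => exists_isCompOf_mem G hv
  obtain ⟨D, -, hD⟩ := exists_le_card_fiber_of_nsmul_le_card_of_maps_to
    (s := L) (t := C.powerset) (f := fun v => vNbr G (f v)) (b := (L.card : ℝ) / 2 ^ k)
    (fun v hv => mem_powerset.mpr ((hf v hv).vNbr_subset hsep)) ⟨∅, empty_mem_powerset C⟩
    (by rw [card_powerset, hC, nsmul_eq_mul]; push_cast; rw [mul_div_cancel₀ _ (by positivity)])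
  have hpos : (0 : ℝ) < (L.card : ℝ) / 2 ^ k := by
    have : (0 : ℝ) < L.card := by exact_mod_cast hL.card_pos
    positivity
  refine ⟨(L.filter fun v => vNbr G (f v) = D).image f, ?_, ?_, ⟨D, ?_⟩, hD.trans ?_⟩
  · exact (card_pos.mp (by exact_mod_cast hpos.trans_le hD)).image f
  · simp only [mem_image, mem_filter]
    rintro _ ⟨v, ⟨hv, -⟩, rfl⟩
    exact hf v hv
  · simp only [mem_image, mem_filter]
    rintro _ ⟨v, ⟨-, hv⟩, rfl⟩
    exact hv
  · refine Nat.cast_le.mpr (card_le_card fun v hv => ?_)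
    exact mem_biUnion.mpr ⟨f v, mem_image_of_mem f hv, hmem v (mem_filter.mp hv).1⟩
end

section
/- Existence of weighted edge sample sets for sparse cuts. There is an absolute constant c ≥ 1 with the following property. Let G be a connected finite simple graph with vertex set V, let μ : V → ℝ≥0 be a measure with K = μ(V) > 0, let ε ∈ (0,1) and let φ' > 0 with K·φ' ≥ 1. Then there exist a nonempty set T ⊆ V and weights α : T → ℝ with α(t) ≥ 1 for every t ∈ T and α(T) ≤ c·K·φ'/ε², such that every W ⊆ V with ∅ ≠ W ≠ V that satisfies either (a) |δ_G(W)| ≤ φ'·μ(W), or (b) |δ_G(W)| ≤ (K/(10·α(T)))·φ'·α(W ∩ T), also satisfies |(K/α(T))·α(W ∩ T) − μ(W)| ≤ ε·μ(W). -/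
open Finset

attribute [local instance] Classical.propDecidable

namespace SimpleGraph

variable {V : Type*} {G : SimpleGraph V}

theorem Connected.exists_parent (hG : G.Connected) (r : V) :
    ∃ p : V → V, ∀ v, v ≠ r → G.Adj v (p v) ∧ G.dist (p v) r < G.dist v r := by
  have h : ∀ v, ∃ w, v ≠ r → G.Adj v w ∧ G.dist w r < G.dist v r := by
    intro v
    by_cases hv : v = r
    · exact ⟨v, fun h => absurd hv h⟩
    obtain ⟨q, hq⟩ := hG.exists_walk_length_eq_dist v r
    cases q with
    | nil => exact absurd rfl hv
    | @cons _ w _ hadj q =>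
      refine ⟨w, fun _ => ⟨hadj, ?_⟩⟩
      have := dist_le q
      rw [Walk.length_cons] at hq
      omega
  choose p hp using h
  exact ⟨p, hp⟩

theorem Connected.one_le_cutSize [Finite V] (hG : G.Connected) {W : Finset V} {u v : V}
    (hu : u ∈ W) (hv : v ∉ W) : 1 ≤ cutSize G W := by
  obtain ⟨q⟩ := hG.preconnected u v
  obtain ⟨d, -, h1, h2⟩ := q.exists_boundary_dart (W : Set V) hu hv
  rw [cutSize, Nat.one_le_iff_ne_zero, ← Nat.pos_iff_ne_zero, Set.ncard_pos (Set.toFinite _)]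
  exact ⟨s(d.fst, d.snd), d.adj, ⟨d.fst, by simp, h1⟩, ⟨d.snd, by simp, h2⟩⟩

/-- The tree edges leaving `W` are among the edges of `G` leaving `W`. -/
theorem card_separated_le_cutSize [Fintype V] {r : V} {p : V → V} {d : V → ℕ}
    (hp : ∀ v, v ≠ r → G.Adj v (p v) ∧ d (p v) < d v) (W : Finset V) :
    #{v | v ≠ r ∧ ¬(p v ∈ W ↔ v ∈ W)} ≤ cutSize G W := by
  rw [cutSize, ← Set.ncard_coe_finset]
  refine Set.ncard_le_ncard_of_injOn (fun v => s(v, p v)) ?_ ?_ (Set.toFinite _)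
  · intro v hv
    simp only [coe_filter, mem_univ, true_and, Set.mem_ofPred_eq] at hv
    refine ⟨(hp v hv.1).1, ?_⟩
    by_cases h : v ∈ W
    · exact ⟨⟨v, by simp, h⟩, ⟨p v, by simp, by tauto⟩⟩
    · exact ⟨⟨p v, by simp, by tauto⟩, ⟨v, by simp, h⟩⟩
  · intro v hv w hw h
    simp only [coe_filter, mem_univ, true_and, Set.mem_ofPred_eq] at hv hw
    rcases Sym2.eq_iff.1 h with h | h
    · exact h.1
    · have h1 := (hp v hv.1).2
      have h2 := (hp w hw.1).2
      rw [h.2] at h1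
      rw [← h.1] at h2
      omega

end SimpleGraph

/-- Greedy upward routing in a rooted forest: every non-root vertex collects its own mass and what
its children send, and forwards the total to its parent exactly when it is below `s`. -/
theorem exists_greedy_flow {V : Type*} [Fintype V] {r : V} {p : V → V} {d : V → ℕ}
    (hp : ∀ v, v ≠ r → d (p v) < d v) (μ : V → ℝ) (s : ℝ) :
    ∃ f : V → ℝ, f r = 0 ∧ ∀ v, v ≠ r →
      f v = if μ v + ∑ w with p w = v ∧ w ≠ r, f w < s
        then μ v + ∑ w with p w = v ∧ w ≠ r, f w else 0 := by
  have wf : WellFounded (fun w v : V => d v < d w) := by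
    have : IsTrans V (fun w v : V => d v < d w) := ⟨fun _ _ _ h1 h2 => lt_trans h2 h1⟩
    have : Std.Irrefl (fun w v : V => d v < d w) := ⟨fun _ h => lt_irrefl _ h⟩
    exact Finite.wellFounded_of_trans_of_irrefl _
  let x : (v : V) → ((w : V) → d v < d w → ℝ) → ℝ := fun v F =>
    μ v + ∑ w, if h : p w = v ∧ w ≠ r then F w (h.1 ▸ hp w h.2) else 0
  let F : (v : V) → ((w : V) → d v < d w → ℝ) → ℝ := fun v F =>
    if v = r then 0 else if x v F < s then x v F else 0
  refine ⟨wf.fix F, ?_, fun v hv => ?_⟩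
  · rw [wf.fix_eq]
    simp [F]
  · conv_lhs => rw [wf.fix_eq]
    simp only [F, if_neg hv, x, sum_filter, dite_eq_ite]

theorem SimpleGraph.Connected.exists_concentrated_measure {V : Type*} [Fintype V]
    {G : SimpleGraph V} (hG : G.Connected) (r : V) {μ : V → ℝ} (hμ : ∀ v, 0 ≤ μ v) {s : ℝ}
    (hs : 0 < s) :
    ∃ ν : V → ℝ, 0 ≤ ν r ∧ (∀ v, v ≠ r → ν v = 0 ∨ s ≤ ν v) ∧ ∑ v, ν v = ∑ v, μ v ∧
      ∀ W : Finset V, |∑ v ∈ W, ν v - ∑ v ∈ W, μ v| ≤ s * cutSize G W := by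
  obtain ⟨p, hp⟩ := hG.exists_parent r
  obtain ⟨f, hfr, hf⟩ := exists_greedy_flow (d := fun v => G.dist v r) (fun v hv => (hp v hv).2) μ s
  have hin : ∀ v, ∑ w with p w = v ∧ w ≠ r, f w = ∑ w with p w = v, f w := by
    intro v
    rw [sum_filter, sum_filter]
    refine sum_congr rfl fun w _ => ?_
    by_cases hw : w = r
    · simp [hw, hfr]
    · simp [hw]
  simp only [hin] at hf
  have hfs : ∀ v, f v ≤ s := by
    intro v
    by_cases hv : v = r
    · rw [hv, hfr]; exact hs.le
    · rw [hf v hv]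
      split_ifs with h
      exacts [h.le, hs.le]
  have hf0_aux : ∀ n v, (∀ w, G.dist w r ≤ n + G.dist v r) → 0 ≤ f v := by
    intro n
    induction n with
    | zero =>
      intro v hn
      by_cases hv : v = r
      · rw [hv, hfr]
      rw [hf v hv, ← hin, filter_eq_empty_iff.2]
      · split_ifs
        · simpa using hμ v
        · exact le_rfl
      · rintro w - ⟨rfl, hw⟩
        have := (hp w hw).2
        have := hn w
        omega
    | succ n ih =>
      intro v hn
      by_cases hv : v = r
      · rw [hv, hfr]
      rw [hf v hv]
      split_ifs
      · rw [← hin]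
        refine add_nonneg (hμ v) (sum_nonneg fun w hw => ih w fun u => ?_)
        simp only [mem_filter, mem_univ, true_and] at hw
        have h1 := (hp w hw.2).2
        rw [hw.1] at h1
        have := hn u
        omega
      · exact le_rfl
  have hf0 : ∀ v, 0 ≤ f v := fun v => hf0_aux (∑ w, G.dist w r) v fun w =>
    le_add_right (single_le_sum (f := fun w => G.dist w r) (fun _ _ => Nat.zero_le _) (mem_univ w))
  have hsum : ∀ W : Finset V, ∑ v ∈ W, (μ v + ∑ w with p w = v, f w - f v) - ∑ v ∈ W, μ v =
      ∑ w, ((if p w ∈ W then f w else 0) - if w ∈ W then f w else 0) := by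
    intro W
    rw [sum_sub_distrib, sum_add_distrib, sum_sub_distrib]
    simp only [sum_filter]
    rw [sum_comm]
    simp only [sum_ite_eq, sum_ite_mem, univ_inter]
    ring
  refine ⟨fun v => μ v + ∑ w with p w = v, f w - f v, ?_, fun v hv => ?_, ?_, fun W => ?_⟩
  · simp only [hfr, sub_zero]
    exact add_nonneg (hμ r) (sum_nonneg fun w _ => hf0 w)
  · have h := hf v hv
    split_ifs at h with h'
    · left; simp only; rw [h]; ring
    · right; simp only; rw [h]; linarith
  · have h := hsum univ
    simp only [mem_univ, if_true, sub_self, sum_const_zero] at h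
    linarith
  · rw [hsum]
    calc |∑ w, ((if p w ∈ W then f w else 0) - if w ∈ W then f w else 0)|
        ≤ ∑ w, |(if p w ∈ W then f w else 0) - if w ∈ W then f w else 0| := abs_sum_le_sum_abs _ _
      _ ≤ ∑ w, if w ≠ r ∧ ¬(p w ∈ W ↔ w ∈ W) then s else 0 := by
        refine sum_le_sum fun w _ => ?_
        by_cases hw : w = r
        · simp [hw, hfr]
        · by_cases h1 : p w ∈ W <;> by_cases h2 : w ∈ W <;>
            simp [hw, h1, h2, abs_of_nonneg (hf0 w), hfs w]
      _ = s * #{v | v ≠ r ∧ ¬(p v ∈ W ↔ v ∈ W)} := by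
        rw [← sum_filter, sum_const, nsmul_eq_mul, mul_comm]
      _ ≤ s * cutSize G W := by
        gcongr
        exact card_separated_le_cutSize (d := fun v => G.dist v r) hp W

/-- Mass can be moved along a spanning tree so that it sits in atoms of size at least `s`, changing
the mass of each vertex set by at most `2 * s` per boundary edge. -/
theorem SimpleGraph.Connected.exists_atomic_measure {V : Type*} [Fintype V]
    {G : SimpleGraph V} (hG : G.Connected) {μ : V → ℝ} (hμ : ∀ v, 0 ≤ μ v) {s : ℝ}
    (hs : 0 < s) (hK : s ≤ ∑ v, μ v) :
    ∃ ν : V → ℝ, (∀ v, ν v = 0 ∨ s ≤ ν v) ∧ ∑ v, ν v = ∑ v, μ v ∧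
      ∀ W : Finset V, |∑ v ∈ W, ν v - ∑ v ∈ W, μ v| ≤ 2 * s * cutSize G W := by
  obtain ⟨r⟩ := hG.nonempty
  obtain ⟨ν, hr, hν, htot, herr⟩ := hG.exists_concentrated_measure r hμ hs
  by_cases hrs : s ≤ ν r
  · refine ⟨ν, fun v => ?_, htot, fun W => (herr W).trans ?_⟩
    · by_cases hv : v = r
      · exact Or.inr (hv ▸ hrs)
      · exact hν v hv
    · have : 0 ≤ s * cutSize G W := by positivity
      linarith
  push Not at hrs
  obtain ⟨t, htr, hts⟩ : ∃ t, t ≠ r ∧ s ≤ ν t := by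
    by_contra! h
    have : ∑ v, ν v = ν r := sum_eq_single r
      (fun v _ hv => (hν v hv).resolve_right (not_le.2 (h v hv))) (by simp)
    linarith
  have hsum : ∀ W : Finset V,
      ∑ v ∈ W, (ν v + ((if v = t then ν r else 0) - if v = r then ν r else 0)) =
      ∑ v ∈ W, ν v + ((if t ∈ W then ν r else 0) - if r ∈ W then ν r else 0) := by
    intro W
    simp [sum_add_distrib]
  refine ⟨fun v => ν v + ((if v = t then ν r else 0) - if v = r then ν r else 0),
    fun v => ?_, ?_, fun W => ?_⟩
  · by_cases hv : v = r
    · left; simp [hv, htr.symm]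
    · by_cases hvt : v = t
      · right; simp only [hvt, htr, if_true, if_false]; linarith
      · simpa [hv, hvt] using hν v hv
  · rw [hsum, ← htot]; simp
  · rw [hsum]
    have h1 : |(if t ∈ W then ν r else 0) - if r ∈ W then ν r else 0| ≤ s * cutSize G W := by
      have key : 1 ≤ cutSize G W → ν r ≤ s * cutSize G W := fun h => by
        have : (1 : ℝ) ≤ cutSize G W := by exact_mod_cast h
        nlinarith
      have h0 : 0 ≤ s * cutSize G W := by positivity
      by_cases ht : t ∈ W <;> by_cases hrW : r ∈ W
      · simpa [ht, hrW] using h0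
      · simpa [ht, hrW, abs_of_nonneg hr] using key (hG.one_le_cutSize ht hrW)
      · simpa [ht, hrW, abs_of_nonneg hr] using key (hG.one_le_cutSize hrW ht)
      · simpa [ht, hrW] using h0
    have h2 := herr W
    rw [abs_le] at h1 h2 ⊢
    constructor <;> linarith [h1.1, h1.2, h2.1, h2.2]

/-- Existence of weighted edge sample sets for sparse cuts. -/
theorem weighted_edge_sample_sets :
    ∃ c : ℝ, 1 ≤ c ∧
      ∀ (V : Type) [Fintype V] (G : SimpleGraph V), G.Connected →
        ∀ μ : V → ℝ, (∀ v, 0 ≤ μ v) →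
        ∀ K : ℝ, K = ∑ v, μ v → 0 < K →
        ∀ ε φ' : ℝ, 0 < ε → ε < 1 → 0 < φ' → 1 ≤ K * φ' →
          ∃ (T : Finset V) (α : V → ℝ), T.Nonempty ∧ (∀ t ∈ T, 1 ≤ α t) ∧
            (∑ t ∈ T, α t) ≤ c * K * φ' / ε ^ 2 ∧
            ∀ W : Finset V, W.Nonempty → W ≠ Finset.univ →
              ((cutSize G W : ℝ) ≤ φ' * (∑ v ∈ W, μ v) ∨
                (cutSize G W : ℝ) ≤ (K / (10 * ∑ t ∈ T, α t)) * φ' *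
                  (∑ t ∈ W ∩ T, α t)) →
              |(K / (∑ t ∈ T, α t)) * (∑ t ∈ W ∩ T, α t) - (∑ v ∈ W, μ v)| ≤
                ε * (∑ v ∈ W, μ v) := by
  refine ⟨2, by norm_num, ?_⟩
  intro V _ G hG μ hμ K hKdef hK ε φ' hε hε1 hφ hKφ
  obtain ⟨s, hs, hsφ⟩ : ∃ s : ℝ, 0 < s ∧ 2 * s * φ' = ε :=
    ⟨ε / (2 * φ'), by positivity, by field_simp⟩
  have hsK : s ≤ ∑ v, μ v := by
    rw [← hKdef]
    by_contra! h
    nlinarith [mul_lt_mul_of_pos_right h hφ]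
  obtain ⟨ν, hν, htot, herr⟩ := hG.exists_atomic_measure hμ hs hsK
  have hWT : ∀ W : Finset V, ∑ t ∈ W ∩ univ.filter (fun v => ν v ≠ 0), ν t / s =
      (∑ v ∈ W, ν v) / s := by
    intro W
    rw [← sum_div, inter_filter, inter_univ, sum_filter_ne_zero]
  have hT : ∑ t ∈ univ.filter (fun v => ν v ≠ 0), ν t / s = K / s := by
    have := hWT univ
    rwa [univ_inter, htot, ← hKdef] at this
  refine ⟨univ.filter (fun v => ν v ≠ 0), fun v => ν v / s, ?_, fun t ht => ?_, ?_, ?_⟩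
  · by_contra h
    rw [not_nonempty_iff_eq_empty.1 h, sum_empty] at hT
    exact (div_pos hK hs).ne hT
  · rw [one_le_div hs]
    exact (hν t).resolve_left (mem_filter.1 ht).2
  · rw [hT, div_le_div_iff₀ hs (by positivity), ← hsφ]
    have : 2 * s * φ' ≤ 1 := by linarith
    have h0 : 0 ≤ K * (2 * s * φ') := by positivity
    nlinarith
  · intro W _ _ h
    simp only [hWT, hT] at h ⊢
    have e1 : K / (K / s) * ((∑ v ∈ W, ν v) / s) = ∑ v ∈ W, ν v := by field_simp
    have e2 : K / (10 * (K / s)) * φ' * ((∑ v ∈ W, ν v) / s) = φ' * (∑ v ∈ W, ν v) / 10 := by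
      field_simp
    rw [e1]
    rw [e2] at h
    have hW := herr W
    have hm : 0 ≤ ∑ v ∈ W, μ v := sum_nonneg fun v _ => hμ v
    rcases h with h | h
    · calc _ ≤ 2 * s * cutSize G W := hW
        _ ≤ 2 * s * (φ' * ∑ v ∈ W, μ v) := by gcongr
        _ = ε * ∑ v ∈ W, μ v := by rw [← hsφ]; ring
    · have hA : 2 * s * cutSize G W ≤ ε * (∑ v ∈ W, ν v) / 10 := by
        calc 2 * s * cutSize G W ≤ 2 * s * (φ' * (∑ v ∈ W, ν v) / 10) := by gcongr
          _ = ε * (∑ v ∈ W, ν v) / 10 := by rw [← hsφ]; ring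
      have hA' := hW.trans hA
      have hn : 0 ≤ ∑ v ∈ W, ν v := sum_nonneg fun v _ => by
        rcases hν v with h | h <;> linarith
      refine hA'.trans ?_
      have h2 : ∑ v ∈ W, ν v ≤ 10 * ∑ v ∈ W, μ v := by
        have := (abs_le.1 hA').2
        nlinarith
      nlinarith
end

section
/- Existence of quasipolynomial-size multicut mimicking networks. There is an absolute constant c ≥ 1 such that the following holds. Let G be a connected finite simple graph and T ⊆ V(G) a set of terminals with cap_G(T) = k ≥ 2, where cap_G(T) is the sum over t ∈ T of the degree of t in G. Then there exists a finite graph G' with T ⊆ V(G') and |V(G')| + |E(G')| ≤ k^{c·(log k)²} that is a multicut mimicking network for (G, T): for every partition 𝒯 = {T₁, …, T_r} of T, the minimum size of a multiway cut for 𝒯 is the same in G and in G'. -/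
open Finset

attribute [local instance] Classical.propDecidable

/-- `F` is a multiway cut in `G` for the partition of the terminal set `S` induced by the
labelling `lab`: `F` is a set of edges of `G` whose deletion disconnects every pair of
terminals with different labels. -/
def IsMultiwayCut {V : Type*} (G : SimpleGraph V) (S : Set V) (lab : V → ℕ)
    (F : Set (Sym2 V)) : Prop :=
  F ⊆ G.edgeSet ∧
    ∀ t₁ ∈ S, ∀ t₂ ∈ S, lab t₁ ≠ lab t₂ → ¬ (G.deleteEdges F).Reachable t₁ t₂

/-- The minimum size of a multiway cut in `G` for the partition of the terminal set `S`
induced by the labelling `lab`. -/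
noncomputable def minMultiwayCut {V : Type*} (G : SimpleGraph V) (S : Set V)
    (lab : V → ℕ) : ℕ :=
  sInf {m | ∃ F : Set (Sym2 V), IsMultiwayCut G S lab F ∧ F.ncard = m}

theorem exists_generic_matrix {P E : Type} (adj : P → E → Prop) :
    ∃ (K : Type) (_ : Field K) (_ : CharZero K) (A : P → E → K),
      (∀ p x, ¬ adj p x → A p x = 0) ∧
      ∀ (ι : Type) [Fintype ι] [DecidableEq ι] (ρ : ι → P) (σ : ι → E),
        Function.Injective ρ → Function.Injective σ → (∀ i, adj (ρ i) (σ i)) →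
        (Matrix.of fun i j => A (ρ i) (σ j)).det ≠ 0 := by
  let R := MvPolynomial (P × E) ℚ
  refine ⟨FractionRing R, inferInstance, inferInstance,
    fun p x => algebraMap R (FractionRing R) (if adj p x then MvPolynomial.X (p, x) else 0),
    fun p x h => by simp [h], ?_⟩
  intro ι _ _ ρ σ hρ hσ hadj
  let M : Matrix ι ι R := Matrix.of fun i j =>
    if adj (ρ i) (σ j) then MvPolynomial.X (ρ i, σ j) else 0
  have hM : M.det ≠ 0 := by
    intro h0
    let c : P × E → ℚ := fun y => if ∃ i, ρ i = y.1 ∧ σ i = y.2 then 1 else 0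
    have h1 : (MvPolynomial.eval c).mapMatrix M = 1 := by
      ext i j
      by_cases hij : i = j
      · subst hij
        simp [M, hadj, c, hρ.eq_iff]
      · have : ¬ ∃ l, ρ l = ρ i ∧ σ l = σ j := by
          rintro ⟨l, h1, h2⟩
          exact hij ((hρ h1).symm.trans (hσ h2))
        simp only [M, RingHom.mapMatrix_apply, Matrix.map_apply, Matrix.of_apply,
          Matrix.one_apply_ne hij]
        split_ifs <;> simp [c, this]
    have h2 := RingHom.map_det (MvPolynomial.eval c) M
    rw [h1, h0] at h2
    simp at h2
  have h3 := RingHom.map_det (algebraMap R (FractionRing R)) M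
  intro h4
  apply hM
  apply IsFractionRing.injective R (FractionRing R)
  rw [h3, map_zero]
  exact h4

theorem exists_supported_solution {K ι E : Type} [Field K] [Fintype ι] [DecidableEq ι]
    [Fintype E] (B : ι → E → K) (σ : ι → E) (hσ : Function.Injective σ)
    (hdet : (Matrix.of fun i j => B i (σ j)).det ≠ 0) (y : ι → K) :
    ∃ h : E → K, (∀ x, x ∉ Set.range σ → h x = 0) ∧ ∀ i, ∑ x, B i x * h x = y i := by
  set M : Matrix ι ι K := Matrix.of fun i j => B i (σ j)
  have hu : IsUnit M.det := isUnit_iff_ne_zero.mpr hdet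
  refine ⟨Function.extend σ (M⁻¹.mulVec y) 0, fun x hx => ?_, fun i => ?_⟩
  · rw [Function.extend_apply' _ _ _ (by simpa using hx)]; rfl
  · have h1 : M.mulVec (M⁻¹.mulVec y) i = y i := by
      rw [Matrix.mulVec_mulVec, Matrix.mul_nonsing_inv _ hu, Matrix.one_mulVec]
    rw [← h1]
    symm
    apply Finset.sum_of_injOn σ (hσ.injOn) (by simp)
    · intro x _ hx
      rw [Function.extend_apply' _ _ _ (by simpa using hx)]; simp
    · intro j _
      simp [M, hσ.extend_apply]

theorem finrank_mul_le_mul_finrank {K R : Type*} [Field K] [CommRing R] [Algebra K R]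
    [FiniteDimensional K R] (M N : Submodule K R) :
    Module.finrank K ↥(M * N) ≤ Module.finrank K M * Module.finrank K N := by
  rw [← Submodule.mulMap_range, ← Module.finrank_tensorProduct (R := K) (S := K)]
  exact LinearMap.finrank_range_le _

theorem finrank_pow_le_pow_finrank {K R : Type*} [Field K] [CommRing R] [Algebra K R]
    [FiniteDimensional K R] (M : Submodule K R) (n : ℕ) :
    Module.finrank K ↥(M ^ (n + 1)) ≤ Module.finrank K M ^ (n + 1) := by
  induction n with
  | zero =>
    rw [zero_add, pow_one (Module.finrank K M)]
    exact (congrArg (fun N : Submodule K R => Module.finrank K N) (pow_one M)).le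
  | succ n ih =>
    rw [pow_succ, pow_succ _ (n + 1)]
    exact (finrank_mul_le_mul_finrank _ _).trans (Nat.mul_le_mul_right _ ih)

/-- Functions with a diagonal evaluation matrix on `s` are at most as many as the dimension. -/
theorem card_le_finrank_of_diagonal {K E : Type*} [Field K] [Finite E]
    (U : Submodule K (E → K)) (s : Finset E)
    (h : ∀ e ∈ s, ∃ r ∈ U, r e ≠ 0 ∧ ∀ g, g ≠ e → r g = 0) :
    #s ≤ Module.finrank K U := by
  choose! r hrU hre hrg using h
  have hli : LinearIndependent K (fun e : s => (⟨r e, hrU e e.2⟩ : U)) := by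
    rw [Fintype.linearIndependent_iff]
    intro c hc i
    have h1 := congrFun (congrArg Subtype.val hc) i
    simp only [Submodule.coe_sum, Submodule.coe_smul, Finset.sum_apply, Pi.smul_apply,
      smul_eq_mul, Submodule.coe_zero, Pi.zero_apply] at h1
    rw [Finset.sum_eq_single i] at h1
    · exact (mul_eq_zero.mp h1).resolve_right (hre i i.2)
    · intro j _ hj
      rw [hrg j j.2 i (fun h => hj (Subtype.ext h.symm)), mul_zero]
    · simp
  simpa using hli.fintype_card_le_finrank

theorem exists_polynomial_subspace (K E : Type*) [Field K] [CharZero K] [Finite E] (n : ℕ) :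
    ∃ U : Submodule K (E → K), Module.finrank K U ≤ n + 1 ∧
      ∀ (s : Finset E) (e : E), #s ≤ n → e ∉ s →
        ∃ p ∈ U, p e ≠ 0 ∧ ∀ g ∈ s, p g = 0 := by
  have := Fintype.ofFinite E
  let x : E → K := fun e => ((Fintype.equivFin E e : ℕ) : K)
  have hx : Function.Injective x := fun e g h =>
    (Fintype.equivFin E).injective (Fin.ext (Nat.cast_injective h))
  refine ⟨Submodule.span K (Set.range fun i : Fin (n + 1) => fun e => x e ^ (i : ℕ)),
    (finrank_range_le_card _).trans (by simp), fun s e hs he => ?_⟩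
  let q : Polynomial K := ∏ g ∈ s, (Polynomial.X - Polynomial.C (x g))
  have hq : q.natDegree < n + 1 := by
    rw [Polynomial.natDegree_prod_of_monic _ _ fun g _ => Polynomial.monic_X_sub_C _]
    simp only [Polynomial.natDegree_X_sub_C, Finset.sum_const, smul_eq_mul, mul_one]
    omega
  refine ⟨fun g => q.eval (x g), ?_, ?_, fun g hg => ?_⟩
  · have : (fun g => q.eval (x g)) =
        ∑ i : Fin (n + 1), q.coeff i • (fun e => x e ^ (i : ℕ)) := by
      funext g
      rw [Polynomial.eval_eq_sum_range' hq, Finset.sum_range]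
      simp
    rw [this]
    exact Submodule.sum_mem _ fun i _ => Submodule.smul_mem _ _
      (Submodule.subset_span ⟨i, rfl⟩)
  · simp only [q, Polynomial.eval_prod, Finset.prod_ne_zero_iff]
    intro g hg
    simp only [Polynomial.eval_sub, Polynomial.eval_X, Polynomial.eval_C]
    exact sub_ne_zero.mpr fun h => he (hx h ▸ hg)
  · simp only [q, Polynomial.eval_prod]
    exact Finset.prod_eq_zero hg (by simp)

/-- The number of edges, with ends given by `a` and `b`, cut by the labelling `φ`. -/
noncomputable def cutCost {V E : Type} [Fintype E] (a b : E → V) (φ : V → ℕ) : ℕ :=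
  #{e | φ (a e) ≠ φ (b e)}

/-- `φ` is a cheapest extension of its restriction to `T`, and every extension not cutting `e`
is strictly more expensive. -/
def ForcesCut {V E : Type} [Fintype E] (a b : E → V) (T : Set V) (φ : V → ℕ) (e : E) : Prop :=
  (∀ ψ, Set.EqOn ψ φ T → cutCost a b φ ≤ cutCost a b ψ) ∧
    ∀ ψ, Set.EqOn ψ φ T → ψ (a e) = ψ (b e) → cutCost a b φ < cutCost a b ψ

/-- The edges `e` and `g` have a common end. -/
def ShareEnd {V E : Type} (a b : E → V) (e g : E) : Prop :=
  a e = a g ∨ a e = b g ∨ b e = a g ∨ b e = b g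

theorem cutCost_relabel {V E : Type} [Fintype E] (a b : E → V) (φ ψ : V → ℕ) (l : ℕ) (D : Set V)
    (hD : ∀ v ∈ D, φ v ≠ l) (hψD : ∀ v ∈ D, ψ v = l) (hψ : ∀ v ∉ D, ψ v = φ v) :
    cutCost a b ψ + #{g | (a g ∈ D ∧ φ (b g) = l) ∨ (b g ∈ D ∧ φ (a g) = l)} ≤
      cutCost a b φ +
        #{g | (a g ∈ D ∧ b g ∉ D ∧ φ (b g) ≠ l) ∨ (b g ∈ D ∧ a g ∉ D ∧ φ (a g) ≠ l)} := by
  unfold cutCost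
  simp only [Finset.card_filter]
  rw [← Finset.sum_add_distrib, ← Finset.sum_add_distrib]
  refine Finset.sum_le_sum fun g _ => ?_
  have h1 := hD (a g)
  have h2 := hD (b g)
  have h3 := hψD (a g)
  have h4 := hψD (b g)
  have h5 := hψ (a g)
  have h6 := hψ (b g)
  split_ifs <;> first | omega | (exfalso; grind)

theorem ForcesCut.exists_matching {V E : Type} [Fintype E] {a b : E → V} {T : Set V}
    {φ : V → ℕ} {e : E} (h : ForcesCut a b T φ e) (ha : a e ∉ T) (hb : b e ∉ T) (l : ℕ) :
    ∃ σ : Option {q : E // a q ∉ T ∧ b q ∉ T ∧ ¬ (φ (a q) = l ∧ φ (b q) = l)} → E,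
      Function.Injective σ ∧
      ∀ i, ShareEnd a b (i.elim e Subtype.val) (σ i) ∧ φ (a (σ i)) ≠ l ∧ φ (b (σ i)) ≠ l := by
  set ι := Option {q : E // a q ∉ T ∧ b q ∉ T ∧ ¬ (φ (a q) = l ∧ φ (b q) = l)}
  let r : ι → E := fun i => i.elim e Subtype.val
  have hrT : ∀ i, a (r i) ∉ T ∧ b (r i) ∉ T := by
    rintro (_ | q)
    exacts [⟨ha, hb⟩, ⟨q.2.1, q.2.2.1⟩]
  let t : ι → Finset E := fun i => {g | ShareEnd a b (r i) g ∧ φ (a g) ≠ l ∧ φ (b g) ≠ l}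
  have hall := (Finset.all_card_le_biUnion_card_iff_exists_injective
    t).mp ?_
  · obtain ⟨σ, hσ, hσm⟩ := hall
    exact ⟨σ, hσ, fun i => by simpa [t] using hσm i⟩
  intro s
  let D : Set V := {v | φ v ≠ l ∧ ∃ i ∈ s, v = a (r i) ∨ v = b (r i)}
  have hDT : ∀ v ∈ D, v ∉ T := by
    rintro v ⟨_, i, _, rfl | rfl⟩
    exacts [(hrT i).1, (hrT i).2]
  have hmem : ∀ i ∈ s, (φ (a (r i)) = l ∨ a (r i) ∈ D) ∧ (φ (b (r i)) = l ∨ b (r i) ∈ D) :=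
    fun i hi => ⟨or_iff_not_imp_left.mpr fun hl => ⟨hl, i, hi, Or.inl rfl⟩,
      or_iff_not_imp_left.mpr fun hl => ⟨hl, i, hi, Or.inr rfl⟩⟩
  let ψ : V → ℕ := fun v => if v ∈ D then l else φ v
  have hEq : Set.EqOn ψ φ T := fun v hv =>
    if_neg fun hvD => hDT v hvD hv
  set inner : Finset E := {g | a g ∈ D ∧ b g ∈ D}
  set toPart : Finset E := {g | (a g ∈ D ∧ φ (b g) = l) ∨ (b g ∈ D ∧ φ (a g) = l)}
  set outer : Finset E :=
    {g | (a g ∈ D ∧ b g ∉ D ∧ φ (b g) ≠ l) ∨ (b g ∈ D ∧ a g ∉ D ∧ φ (a g) ≠ l)}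
  have hcost : cutCost a b ψ + #toPart ≤ cutCost a b φ + #outer := by
    convert cutCost_relabel a b φ ψ l D (fun v hv => hv.1) (fun v hv => if_pos hv)
      (fun v hv => if_neg hv)
  have hlower : #inner + #outer ≤ #(s.biUnion t) := by
    rw [← Finset.card_union_of_disjoint]
    · refine Finset.card_le_card fun g hg => ?_
      have key : (a g ∈ D ∨ b g ∈ D) ∧ φ (a g) ≠ l ∧ φ (b g) ≠ l := by
        simp only [inner, outer, Finset.mem_union, Finset.mem_filter, Finset.mem_univ,
          true_and] at hg
        have h1 : a g ∈ D → φ (a g) ≠ l := fun h => h.1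
        have h2 : b g ∈ D → φ (b g) ≠ l := fun h => h.1
        tauto
      simp only [t, Finset.mem_biUnion, Finset.mem_filter, Finset.mem_univ, true_and]
      obtain ⟨⟨_, i, hi, h1⟩ | ⟨_, i, hi, h1⟩, h2⟩ := key
      · exact ⟨i, hi, by unfold ShareEnd; rcases h1 with h1 | h1 <;> simp [h1], h2⟩
      · exact ⟨i, hi, by unfold ShareEnd; rcases h1 with h1 | h1 <;> simp [h1], h2⟩
    · rw [Finset.disjoint_left]
      intro g hg hg'
      simp only [inner, outer, Finset.mem_filter, Finset.mem_univ, true_and] at hg hg'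
      tauto
  have hupper : #(s.erase none) ≤ #inner + #toPart := by
    refine le_trans ?_ (Finset.card_union_le _ _)
    refine Finset.card_le_card_of_injOn r ?_ ?_
    · rintro (_ | q) hq
      · simp at hq
      · have h1 := hmem _ (Finset.mem_of_mem_erase hq)
        have h2 : ¬ (φ (a (r (some q))) = l ∧ φ (b (r (some q))) = l) := q.2.2.2
        simp only [inner, toPart, Finset.coe_union, Finset.coe_filter, Finset.mem_univ, true_and,
          Set.mem_union, Set.mem_ofPred_eq]
        tauto
    · rintro (_ | q) hq (_ | q') hq' hqq'
      · rfl
      · simp at hq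
      · simp at hq'
      · exact congrArg some (Subtype.ext hqq')
  by_cases hnone : none ∈ s
  · have h1 := h.2 _ hEq (by
      have h2 := hmem none hnone
      have h3 : ∀ v, (φ v = l ∨ v ∈ D) → ψ v = l := by
        intro v hv
        simp only [ψ]
        split_ifs <;> tauto
      exact (h3 _ h2.1).trans (h3 _ h2.2).symm)
    have h2 := Finset.card_erase_add_one hnone
    omega
  · have h1 := h.1 _ hEq
    rw [Finset.erase_eq_of_notMem hnone] at hupper
    omega

theorem exists_separating_subspace {V E : Type} [Fintype E] (a b : E → V) (T : Set V) :
    ∃ (K : Type) (_ : Field K) (_ : CharZero K) (W : Submodule K (E → K)),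
      Module.finrank K W ≤ #{e | a e ∈ T ∨ b e ∈ T} ∧
      ∀ φ e l, ForcesCut a b T φ e → a e ∉ T → b e ∉ T →
        ∃ w ∈ W, w e ≠ 0 ∧ ∀ g, φ (a g) = l → φ (b g) = l → w g = 0 := by
  obtain ⟨K, _, _, A, hA0, hA⟩ := exists_generic_matrix
    (fun (p : Bool × E) g => ShareEnd a b p.2 g)
  let L : (E → K) →ₗ[K] (E → K) := (Matrix.of fun e g => A (true, e) g).mulVecLin
  let W₀ : Submodule K (E → K) :=
    { carrier := {h | ∀ q, a q ∉ T → b q ∉ T → ∑ g, A (false, q) g * h g = 0}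
      zero_mem' := fun q _ _ => by simp
      add_mem' := fun {h h'} hh hh' q hqa hqb => by
        simp [mul_add, Finset.sum_add_distrib, hh q hqa hqb, hh' q hqa hqb]
      smul_mem' := fun c h hh q hqa hqb => by
        have := hh q hqa hqb
        simp only [Pi.smul_apply, smul_eq_mul, mul_left_comm _ c, ← Finset.mul_sum, this,
          mul_zero] }
  refine ⟨K, inferInstance, inferInstance, W₀.map L, ?_, ?_⟩
  · refine (Submodule.finrank_map_le _ _).trans ?_
    let res : W₀ →ₗ[K] ({e : E // a e ∈ T ∨ b e ∈ T} → K) :=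
      (LinearMap.funLeft K K Subtype.val).comp W₀.subtype
    have hinj : Function.Injective res := by
      rw [← LinearMap.ker_eq_bot, LinearMap.ker_eq_bot']
      intro h hh
      have hT : ∀ g, (a g ∈ T ∨ b g ∈ T) → h.1 g = 0 := fun g hg => congrFun hh ⟨g, hg⟩
      let ι := {q : E // a q ∉ T ∧ b q ∉ T}
      have hdet := hA ι (fun q => (false, q.1)) Subtype.val
        (fun p q hpq => Subtype.ext (Prod.ext_iff.mp hpq).2) Subtype.val_injective
        (fun q => Or.inl rfl)
      have h1 : (fun q : ι => h.1 q.1) = 0 := by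
        apply Matrix.eq_zero_of_mulVec_eq_zero hdet
        funext q
        rw [Pi.zero_apply, ← h.2 q.1 q.2.1 q.2.2]
        apply Finset.sum_of_injOn Subtype.val Subtype.val_injective.injOn (by simp)
        · intro g _ hg
          rw [hT g, mul_zero]
          by_contra hcon
          push Not at hcon
          exact hg ⟨⟨g, hcon⟩, by simp⟩
        · intro g _
          rfl
      ext g
      by_cases hg : a g ∈ T ∨ b g ∈ T
      · exact hT g hg
      · push Not at hg
        exact congrFun h1 ⟨g, hg⟩
    have h2 := LinearMap.finrank_le_finrank_of_injective hinj
    rwa [Module.finrank_fintype_fun_eq_card, Fintype.card_subtype] at h2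
  · intro φ e l hφ hae hbe
    let ι := Option {q : E // a q ∉ T ∧ b q ∉ T ∧ ¬ (φ (a q) = l ∧ φ (b q) = l)}
    obtain ⟨σ, hσ, hσm⟩ : ∃ σ : ι → E, Function.Injective σ ∧
        ∀ i, ShareEnd a b (i.elim e Subtype.val) (σ i) ∧ φ (a (σ i)) ≠ l ∧ φ (b (σ i)) ≠ l :=
      hφ.exists_matching hae hbe l
    let ρ : ι → Bool × E := fun i => i.elim (true, e) fun q => (false, q.1)
    have hρ : Function.Injective ρ := by
      rintro (_ | q) (_ | q') hq
      · rfl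
      · simp [ρ] at hq
      · simp [ρ] at hq
      · exact congrArg some (Subtype.ext (Prod.ext_iff.mp hq).2)
    have hdet := hA ι ρ σ hρ hσ (by
      rintro (_ | q)
      exacts [(hσm none).1, (hσm (some q)).1])
    obtain ⟨h, hsupp, hsol⟩ := exists_supported_solution (fun i => A (ρ i)) σ hσ hdet
      (fun i => if i = none then 1 else 0)
    have hzero : ∀ g, (φ (a g) = l ∨ φ (b g) = l) → h g = 0 := by
      intro g hg
      apply hsupp
      rintro ⟨i, rfl⟩
      have := (hσm i).2
      tauto
    have hinside : ∀ c g, φ (a g) = l → φ (b g) = l → ∑ x, A (c, g) x * h x = 0 := by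
      intro c g hga hgb
      refine Finset.sum_eq_zero fun x _ => ?_
      by_cases hx : ShareEnd a b g x
      · rw [hzero x, mul_zero]
        rcases hx with hx | hx | hx | hx <;> simp [← hx, hga, hgb]
      · rw [hA0 (c, g) x hx, zero_mul]
    refine ⟨L h, ⟨h, ?_, rfl⟩, ?_, fun g => hinside true g⟩
    · intro q hqa hqb
      by_cases hq : φ (a q) = l ∧ φ (b q) = l
      · exact hinside false q hq.1 hq.2
      · simpa [ρ] using hsol (some ⟨q, hqa, hqb, hq⟩)
    · have h1 := hsol none
      simp only [if_true, ρ, Option.elim] at h1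
      change ∑ x, A (true, e) x * h x ≠ 0
      rw [h1]
      exact one_ne_zero

theorem prod_mem_submodule_pow {K R : Type*} [Field K] [CommRing R] [Algebra K R]
    (M : Submodule K R) {n : ℕ} (w : Fin n → R) (hw : ∀ i, w i ∈ M) : ∏ i, w i ∈ M ^ n := by
  induction n with
  | zero =>
    rw [Fin.prod_univ_zero, pow_zero]
    exact Submodule.one_le.mp le_rfl
  | succ n ih =>
    rw [Fin.prod_univ_castSucc, pow_succ]
    exact Submodule.mul_mem_mul (ih _ fun i => hw _) (hw _)

/-- The number of edge ends lying in `T`. -/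
noncomputable def terminalCapacity {V E : Type} [Fintype E] (a b : E → V) (T : Set V) : ℕ :=
  ∑ e, ((if a e ∈ T then 1 else 0) + if b e ∈ T then 1 else 0)

theorem card_terminal_edges_le {V E : Type} [Fintype E] (a b : E → V) (T : Set V) :
    #{e | a e ∈ T ∨ b e ∈ T} ≤ terminalCapacity a b T := by
  rw [Finset.card_filter, terminalCapacity]
  refine Finset.sum_le_sum fun e _ => ?_
  split_ifs <;> first | omega | (exfalso; tauto)

theorem ForcesCut.cutCost_le {V E : Type} [Fintype E] {a b : E → V} {T : Set V} {φ : V → ℕ}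
    {e : E} (h : ForcesCut a b T φ e) : cutCost a b φ ≤ terminalCapacity a b T := by
  refine (h.1 (fun v => if v ∈ T then φ v else 0) fun v hv => if_pos hv).trans
    (le_trans ?_ (card_terminal_edges_le a b T))
  refine Finset.card_le_card fun g => ?_
  simp only [Finset.mem_filter, Finset.mem_univ, true_and]
  contrapose!
  rintro ⟨h1, h2⟩
  rw [if_neg h1, if_neg h2]

theorem ForcesCut.ne {V E : Type} [Fintype E] {a b : E → V} {T : Set V} {φ : V → ℕ}
    {e : E} (h : ForcesCut a b T φ e) : φ (a e) ≠ φ (b e) :=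
  fun he => (h.2 φ (fun _ _ => rfl) he).false

theorem cutCost_subtype {V E : Type} [Fintype E] (a b : E → V) (p : E → Prop)
    [Fintype {g // p g}] (ψ : V → ℕ) :
    cutCost (fun g : {g // p g} => a g) (fun g : {g // p g} => b g) ψ =
      #{g | p g ∧ ψ (a g) ≠ ψ (b g)} := by
  unfold cutCost
  refine Finset.card_bij (fun g _ => g.1) ?_ ?_ ?_
  · intro g hg
    simpa [g.2] using hg
  · intro g _ g' _ h
    exact Subtype.ext h
  · intro g hg
    simp only [Finset.mem_filter, Finset.mem_univ, true_and] at hg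
    exact ⟨⟨g, hg.1⟩, by simpa using hg.2, rfl⟩

theorem cutCost_add_subtype {V E : Type} [Fintype E] (a b : E → V) (p : E → Prop)
    [Fintype {g // p g}] (φ ψ : V → ℕ)
    (h : ∀ g, ¬ p g → ψ (a g) = φ (a g) ∧ ψ (b g) = φ (b g)) :
    cutCost a b ψ + cutCost (fun g : {g // p g} => a g) (fun g : {g // p g} => b g) φ =
      cutCost a b φ + cutCost (fun g : {g // p g} => a g) (fun g : {g // p g} => b g) ψ := by
  rw [cutCost_subtype, cutCost_subtype]
  unfold cutCost
  simp only [Finset.card_filter]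
  rw [← Finset.sum_add_distrib, ← Finset.sum_add_distrib]
  refine Finset.sum_congr rfl fun g _ => ?_
  by_cases hg : p g
  · simp only [hg, true_and]
    omega
  · simp [hg, h g hg]

theorem ForcesCut.restrict {V E : Type} [Fintype E] {a b : E → V} {T : Set V} {φ : V → ℕ}
    {e : E} (h : ForcesCut a b T φ e) (S : Set V) (he : a e ∈ S ∨ b e ∈ S) :
    ForcesCut (fun g : {g // a g ∈ S ∨ b g ∈ S} => a g)
      (fun g : {g // a g ∈ S ∨ b g ∈ S} => b g) (T ∪ Sᶜ) φ ⟨e, he⟩ := by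
  have key : ∀ ψ, Set.EqOn ψ φ (T ∪ Sᶜ) → _ := fun ψ hψ =>
    cutCost_add_subtype a b (fun g => a g ∈ S ∨ b g ∈ S) φ ψ fun g hg =>
      ⟨hψ (Or.inr fun h => hg (Or.inl h)), hψ (Or.inr fun h => hg (Or.inr h))⟩
  refine ⟨fun ψ hψ => ?_, fun ψ hψ heq => ?_⟩
  · have h1 := h.1 ψ (hψ.mono Set.subset_union_left)
    have h2 := key ψ hψ
    omega
  · have h1 := h.2 ψ (hψ.mono Set.subset_union_left) heq
    have h2 := key ψ hψ
    omega

/-- The vertices with label `l`. -/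
def labelClass {V : Type} (φ : V → ℕ) (l : ℕ) : Set V := {v | φ v = l}

/-- The terminal capacity of the part of `φ` with label `l`, when everything outside of the part
is made terminal. -/
noncomputable def partCapacity {V E : Type} [Fintype E] (a b : E → V) (T : Set V) (φ : V → ℕ)
    (l : ℕ) : ℕ :=
  terminalCapacity (fun g : {g // a g ∈ labelClass φ l ∨ b g ∈ labelClass φ l} => a g)
    (fun g : {g // a g ∈ labelClass φ l ∨ b g ∈ labelClass φ l} => b g) (T ∪ (labelClass φ l)ᶜ)

theorem terminalCapacity_subtype {V E : Type} [Fintype E] (a b : E → V) (T : Set V)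
    (p : E → Prop) [Fintype {e // p e}] :
    terminalCapacity (fun g : {e // p e} => a g) (fun g : {e // p e} => b g) T =
      ∑ g with p g, ((if a g ∈ T then 1 else 0) + (if b g ∈ T then 1 else 0)) :=
  (Finset.sum_subtype (F := inferInstance) (p := p) ({g | p g} : Finset E) (by simp)
    (fun g => (if a g ∈ T then 1 else 0) + (if b g ∈ T then 1 else 0))).symm

theorem sum_partCapacity_le {V E : Type} [Fintype E] (a b : E → V) (T : Set V) (φ : V → ℕ)
    (L : Finset ℕ) :
    ∑ l ∈ L, partCapacity a b T φ l ≤ terminalCapacity a b T + 2 * cutCost a b φ := by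
  let cut : E → ℕ := fun g => if φ (a g) ≠ φ (b g) then 1 else 0
  let ta : E → ℕ := fun g => if a g ∈ T then 1 else 0
  let tb : E → ℕ := fun g => if b g ∈ T then 1 else 0
  have h1 : ∀ l, partCapacity a b T φ l ≤
      ∑ g, ((if φ (a g) = l then ta g + cut g else 0) +
        (if φ (b g) = l then tb g + cut g else 0)) := by
    intro l
    rw [partCapacity, terminalCapacity_subtype a b, Finset.sum_filter]
    refine Finset.sum_le_sum fun g _ => ?_
    simp only [labelClass, Set.mem_union, Set.mem_compl_iff, Set.mem_ofPred_eq, cut, ta, tb]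
    split_ifs <;> first | omega | (exfalso; grind)
  calc ∑ l ∈ L, partCapacity a b T φ l
      ≤ ∑ l ∈ L, ∑ g, ((if φ (a g) = l then ta g + cut g else 0) +
        (if φ (b g) = l then tb g + cut g else 0)) := Finset.sum_le_sum fun l _ => h1 l
    _ = ∑ g, ∑ l ∈ L, ((if φ (a g) = l then ta g + cut g else 0) +
        (if φ (b g) = l then tb g + cut g else 0)) := Finset.sum_comm
    _ ≤ ∑ g, ((ta g + tb g) + 2 * cut g) := by
        refine Finset.sum_le_sum fun g _ => ?_
        rw [Finset.sum_add_distrib, Finset.sum_ite_eq, Finset.sum_ite_eq]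
        split_ifs <;> omega
    _ = terminalCapacity a b T + 2 * cutCost a b φ := by
        rw [Finset.sum_add_distrib, ← Finset.mul_sum, cutCost, Finset.card_filter]
        rfl

theorem exists_fin_cover (B : Finset ℕ) {n : ℕ} (hB : #B ≤ n) :
    ∃ f : Fin n → ℕ, ∀ l ∈ B, ∃ i, f i = l := by
  refine ⟨fun i => B.toList.getD i 0, fun l hl => ?_⟩
  obtain ⟨i, hi, hil⟩ := List.mem_iff_getElem.mp (Finset.mem_toList.mpr hl)
  have hi' : i < n := by
    rw [Finset.length_toList] at hi
    omega
  exact ⟨⟨i, hi'⟩, by simp [List.getElem?_eq_getElem hi, hil]⟩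

/-- A network in which every edge without terminal ends is forced to be cut by some terminal
labelling has quasipolynomial size. -/
theorem card_edges_le_of_forcesCut {V : Type} (k : ℕ) :
    ∀ (E : Type) [Fintype E] (a b : E → V) (T : Set V), terminalCapacity a b T = k →
      (∀ e, a e ∉ T → b e ∉ T → ∃ φ, ForcesCut a b T φ e) →
      Fintype.card E ≤ k * (6 * k ^ 5) ^ (Nat.log 2 k + 1) := by
  induction k using Nat.strong_induction_on with
  | _ k ih =>
  intro E _ a b T hk hforced
  have hterm := (card_terminal_edges_le a b T).trans hk.le
  rcases Nat.eq_zero_or_pos k with h0 | hpos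
  · rw [h0, zero_mul, Nat.le_zero, Fintype.card_eq_zero_iff]
    refine ⟨fun e => ?_⟩
    have he : ¬ (a e ∈ T ∨ b e ∈ T) := fun he => by
      have := Finset.card_pos.mpr ⟨e, by simpa using he⟩ |>.trans_le hterm
      omega
    push Not at he
    obtain ⟨φ, hφ⟩ := hforced e he.1 he.2
    have h1 : cutCost a b φ = 0 := by
      have := hφ.cutCost_le
      omega
    rw [cutCost, Finset.card_eq_zero, Finset.filter_eq_empty_iff] at h1
    exact h1 (Finset.mem_univ e) hφ.ne
  set R := (6 * k ^ 5) ^ Nat.log 2 k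
  have hsmallpart : ∀ φ l, 2 * partCapacity a b T φ l ≤ k →
      #{g | φ (a g) = l ∨ φ (b g) = l} ≤ partCapacity a b T φ l * R := by
    intro φ l hl
    set c := partCapacity a b T φ l with hc
    have hcard : #{g | φ (a g) = l ∨ φ (b g) = l} ≤ c * (6 * c ^ 5) ^ (Nat.log 2 c + 1) := by
      have := ih c (by omega) {g // a g ∈ labelClass φ l ∨ b g ∈ labelClass φ l}
          (fun g => a g) (fun g => b g) (T ∪ (labelClass φ l)ᶜ) rfl (fun g hga hgb => by
            simp only [Set.mem_union, not_or] at hga hgb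
            obtain ⟨φ', h'⟩ := hforced g.1 hga.1 hgb.1
            exact ⟨φ', h'.restrict _ g.2⟩)
      rw [Fintype.card_subtype] at this
      convert this <;> rfl
    rcases Nat.eq_zero_or_pos c with h0 | hcpos
    · rw [h0] at hcard ⊢
      rw [zero_mul] at hcard ⊢
      exact hcard
    · refine hcard.trans (Nat.mul_le_mul_left _ ?_)
      have hlog : Nat.log 2 c + 1 ≤ Nat.log 2 k := by
        rw [← Nat.log_mul_base (by norm_num) (by omega)]
        exact Nat.log_mono_right (by omega)
      exact (Nat.pow_le_pow_left (by gcongr; omega) _).trans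
        (Nat.pow_le_pow_right (by positivity) hlog)
  obtain ⟨K, _, _, W, hWrank, hW⟩ := exists_separating_subspace a b T
  obtain ⟨U, hUrank, hU⟩ := exists_polynomial_subspace K E (k + 3 * k * R)
  set E₀ : Finset E := {e | ¬ (a e ∈ T ∨ b e ∈ T)} with hE₀
  have hdiag : #E₀ ≤ Module.finrank K ↥(W ^ 5 * U) := by
    apply card_le_finrank_of_diagonal
    intro e he
    have he' : a e ∉ T ∧ b e ∉ T := by simpa [E₀] using he
    obtain ⟨φ, hφ⟩ := hforced e he'.1 he'.2
    have hcost := hφ.cutCost_le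
    let c := partCapacity a b T φ
    let L : Finset ℕ := Finset.univ.image fun g => φ (a g)
    have hsum : ∀ L', ∑ l ∈ L', c l ≤ 3 * k := fun L' =>
      (sum_partCapacity_le a b T φ L').trans (by omega)
    let big : Finset ℕ := {l ∈ L | k < 2 * c l}
    let small : Finset ℕ := {l ∈ L | ¬ k < 2 * c l}
    have hbig : #big ≤ 5 := by
      have h1 : #big * (k + 1) ≤ ∑ l ∈ big, 2 * c l := by
        rw [← smul_eq_mul]
        refine Finset.card_nsmul_le_sum _ _ _ fun l hl => ?_
        exact (Finset.mem_filter.mp hl).2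
      rw [← Finset.mul_sum] at h1
      have h2 := hsum big
      by_contra hcon
      have : 6 * (k + 1) ≤ #big * (k + 1) := Nat.mul_le_mul_right _ (by omega)
      omega
    obtain ⟨f, hf⟩ := exists_fin_cover big hbig
    let cutEdges : Finset E := {g | φ (a g) ≠ φ (b g)}
    let s : Finset E := (cutEdges ∪
      small.biUnion fun l => ({g | φ (a g) = l ∨ φ (b g) = l} : Finset E)).erase e
    have hs : #s ≤ k + 3 * k * R := by
      refine Finset.card_erase_le.trans ((Finset.card_union_le _ _).trans ?_)
      refine Nat.add_le_add (hcost.trans hk.le) (Finset.card_biUnion_le.trans ?_)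
      calc _ ≤ ∑ l ∈ small, c l * R := Finset.sum_le_sum fun l hl =>
            hsmallpart φ l (not_lt.mp (Finset.mem_filter.mp hl).2)
        _ = (∑ l ∈ small, c l) * R := (Finset.sum_mul _ _ _).symm
        _ ≤ 3 * k * R := Nat.mul_le_mul_right _ (hsum small)
    obtain ⟨p, hpU, hpe, hps⟩ := hU s e hs (Finset.notMem_erase _ _)
    choose w hwW hwe hwg using fun i : Fin 5 => hW φ e (f i) hφ he'.1 he'.2
    refine ⟨(∏ i, w i) * p, Submodule.mul_mem_mul (prod_mem_submodule_pow W w hwW) hpU, ?_, ?_⟩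
    · rw [Pi.mul_apply, Finset.prod_apply]
      exact mul_ne_zero (Finset.prod_ne_zero_iff.mpr fun i _ => hwe i) hpe
    · intro g hge
      rw [Pi.mul_apply, Finset.prod_apply]
      by_cases hgs : g ∈ s
      · rw [hps g hgs, mul_zero]
      · simp only [s, cutEdges, Finset.mem_erase, ne_eq, hge, not_false_eq_true, true_and,
          Finset.mem_union, Finset.mem_filter, Finset.mem_univ, not_or, not_not,
          Finset.mem_biUnion, not_exists, not_and] at hgs
        have hL : φ (a g) ∈ L := Finset.mem_image_of_mem _ (Finset.mem_univ g)
        have hgbig : φ (a g) ∈ big := by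
          by_contra hcon
          have : φ (a g) ∈ small := by
            simp only [big, small, Finset.mem_filter, hL, true_and] at hcon ⊢
            exact hcon
          exact (hgs.2 _ this).1 rfl
        obtain ⟨i, hi⟩ := hf _ hgbig
        rw [Finset.prod_eq_zero (Finset.mem_univ i) (hwg i g hi.symm (hgs.1 ▸ hi.symm)), zero_mul]
  have hrank : Module.finrank K ↥(W ^ 5 * U) ≤ k ^ 5 * (k + 3 * k * R + 1) := by
    refine (finrank_mul_le_mul_finrank _ _).trans (Nat.mul_le_mul ?_ hUrank)
    refine (finrank_pow_le_pow_finrank W 4).trans (Nat.pow_le_pow_left ?_ 5)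
    exact hWrank.trans hterm
  have hsplit := Finset.card_filter_add_card_filter_not (s := (Finset.univ : Finset E))
    (fun e => a e ∈ T ∨ b e ∈ T)
  have htotal : Fintype.card E ≤ k + k ^ 5 * (k + 3 * k * R + 1) := by
    rw [Finset.card_univ] at hsplit
    rw [← hsplit]
    exact Nat.add_le_add hterm (hdiag.trans hrank)
  refine htotal.trans ?_
  have hR : 1 ≤ R := Nat.one_le_iff_ne_zero.mpr (by positivity)
  have h5 : 1 ≤ k ^ 5 := Nat.one_le_iff_ne_zero.mpr (by positivity)
  rw [pow_succ]
  change _ ≤ k * (R * (6 * k ^ 5))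
  have e1 : k ≤ k * k ^ 5 * R := by
    calc k = k * 1 * 1 := by ring
      _ ≤ _ := by gcongr
  have e2 : k ^ 5 * k ≤ k * k ^ 5 * R := by
    calc k ^ 5 * k = k * k ^ 5 * 1 := by ring
      _ ≤ _ := by gcongr
  have e3 : k ^ 5 ≤ k * k ^ 5 * R := by
    calc k ^ 5 = 1 * k ^ 5 * 1 := by ring
      _ ≤ _ := by gcongr; omega
  nlinarith


/-- Identifying the vertices with the same image under `π` keeps the terminals `T` apart and
preserves the cost of the cheapest extension of every terminal labelling. -/
def IsContraction {V E : Type} [Fintype E] (a b : E → V) (T : Set V) (π : V → V) : Prop :=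
  (∀ v ∈ T, π v = v) ∧ (∀ v ∉ T, π v ∉ T) ∧
    ∀ φ : V → ℕ, ∃ χ : V → ℕ, Set.EqOn χ φ T ∧
      cutCost (fun e => π (a e)) (fun e => π (b e)) χ ≤ cutCost a b φ

theorem exists_cheapest_extension {V E : Type} [Fintype E] (a b : E → V) (T : Set V)
    (χ : V → ℕ) :
    ∃ φ, Set.EqOn φ χ T ∧ ∀ ψ, Set.EqOn ψ φ T → cutCost a b φ ≤ cutCost a b ψ := by
  obtain ⟨φ, hφ, hmin⟩ := (measure (cutCost a b)).wf.has_min {φ | Set.EqOn φ χ T}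
    ⟨χ, fun _ _ => rfl⟩
  exact ⟨φ, hφ, fun ψ hψ => not_lt.mp (hmin ψ (hψ.trans hφ))⟩

theorem cutCost_subtype_ne {V E : Type} [Fintype E] (a b : E → V)
    [Fintype {e // a e ≠ b e}] (χ : V → ℕ) :
    cutCost (fun e : {e // a e ≠ b e} => a e) (fun e : {e // a e ≠ b e} => b e) χ =
      cutCost a b χ := by
  rw [cutCost_subtype, cutCost]
  congr 1
  ext g
  simp only [Finset.mem_filter, Finset.mem_univ, true_and, and_iff_right_iff_imp]
  exact fun h h' => h (congrArg χ h')

theorem exists_minimal_contraction {V E : Type} [Fintype E] (a b : E → V) (T : Set V) :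
    ∃ π, IsContraction a b T π ∧
      ∀ e : {e // π (a e) ≠ π (b e)}, π (a e) ∉ T → π (b e) ∉ T →
        ∃ φ, ForcesCut (fun g : {e // π (a e) ≠ π (b e)} => π (a g)) (fun g => π (b g)) T φ e := by
  obtain ⟨π, hπ, hmin⟩ := (measure fun π : V → V => #{e | π (a e) ≠ π (b e)}).wf.has_min
    {π | IsContraction a b T π} ⟨id, fun _ _ => rfl, fun _ h => h, fun φ => ⟨φ, fun _ _ => rfl, le_rfl⟩⟩
  refine ⟨π, hπ, ?_⟩
  rintro ⟨e, he⟩ hae hbe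
  by_contra! hcon
  let κ : V → V := fun v => if v = π (b e) then π (a e) else v
  refine hmin (κ ∘ π) ⟨fun v hv => ?_, fun v hv => ?_, fun φ => ?_⟩ ?_
  · rw [Function.comp_apply, hπ.1 v hv]
    exact if_neg fun h : v = π (b e) => hbe (h ▸ hv)
  · simp only [Function.comp_apply, κ]
    split_ifs
    exacts [hae, hπ.2.1 v hv]
  · obtain ⟨χ, hχ, hχc⟩ := hπ.2.2 φ
    obtain ⟨φ₀, hφ₀, hφ₀min⟩ := exists_cheapest_extension
      (fun g : {e // π (a e) ≠ π (b e)} => π (a g)) (fun g => π (b g)) T χ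
    have h1 := hcon φ₀
    simp only [ForcesCut, not_and, not_forall, not_lt] at h1
    obtain ⟨ψ, hψ, hψe, hψc⟩ := h1 hφ₀min
    refine ⟨ψ, hψ.trans (hφ₀.trans hχ), le_trans ?_ hχc⟩
    have hκ : ∀ v, ψ (κ v) = ψ v := fun v => by
      simp only [κ]
      split_ifs with hv
      exacts [hv ▸ hψe, rfl]
    have h2 : cutCost (fun e => (κ ∘ π) (a e)) (fun e => (κ ∘ π) (b e)) ψ =
        cutCost (fun e => π (a e)) (fun e => π (b e)) ψ := by
      simp only [cutCost, Function.comp_apply, hκ]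
    rw [h2, ← cutCost_subtype_ne (fun e => π (a e)) (fun e => π (b e)),
      ← cutCost_subtype_ne (fun e => π (a e)) (fun e => π (b e)) χ]
    exact hψc.trans (hφ₀min χ hφ₀.symm)
  · refine Finset.card_lt_card (Finset.ssubset_iff_subset_ne.mpr ⟨fun g => ?_, fun h => ?_⟩)
    · simp only [Finset.mem_filter, Finset.mem_univ, true_and]
      exact fun h h' => h (congrArg κ h')
    · have : e ∈ ({e | π (a e) ≠ π (b e)} : Finset E) := by simpa using he
      rw [← h] at this
      simp [κ] at this

theorem IsContraction.terminalCapacity_le {V E : Type} [Fintype E] {a b : E → V} {T : Set V}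
    {π : V → V} (h : IsContraction a b T π) (p : E → Prop) [Fintype {e // p e}] :
    terminalCapacity (fun g : {e // p e} => π (a g)) (fun g => π (b g)) T ≤
      terminalCapacity a b T := by
  have hT : ∀ v, π v ∈ T ↔ v ∈ T := fun v =>
    ⟨fun hv => by_contra fun hv' => h.2.1 v hv' hv, fun hv => by rwa [h.1 v hv]⟩
  rw [terminalCapacity_subtype (fun g => π (a g)) (fun g => π (b g))]
  simp only [hT]
  exact Finset.sum_le_sum_of_subset (Finset.filter_subset _ _)

/-- The edges of `G` whose ends have different labels. -/
def bichromaticEdges {V : Type} (G : SimpleGraph V) (φ : V → ℕ) : Set (Sym2 V) :=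
  {e | ∃ u v, G.Adj u v ∧ φ u ≠ φ v ∧ s(u, v) = e}

theorem minMultiwayCut_le_ncard_bichromaticEdges {V : Type} (G : SimpleGraph V) (S : Set V)
    (lab φ : V → ℕ) (h : Set.EqOn φ lab S) :
    minMultiwayCut G S lab ≤ (bichromaticEdges G φ).ncard := by
  refine Nat.sInf_le ⟨bichromaticEdges G φ, ⟨?_, fun t₁ h₁ t₂ h₂ hne => ?_⟩, rfl⟩
  · rintro _ ⟨u, v, huv, _, rfl⟩
    exact huv
  · rintro ⟨w⟩
    apply hne
    rw [← h h₁, ← h h₂]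
    clear h₁ h₂ hne
    induction w with
    | nil => rfl
    | cons hadj _ ih =>
      rw [← ih]
      by_contra hcon
      rw [SimpleGraph.deleteEdges_adj] at hadj
      exact hadj.2 ⟨_, _, hadj.1, hcon, rfl⟩

theorem exists_ncard_bichromaticEdges_le {V : Type} [Finite V] (G : SimpleGraph V) (S : Set V)
    (lab : V → ℕ) :
    ∃ φ, Set.EqOn φ lab S ∧ (bichromaticEdges G φ).ncard ≤ minMultiwayCut G S lab := by
  have hne : {m | ∃ F : Set (Sym2 V), IsMultiwayCut G S lab F ∧ F.ncard = m}.Nonempty := by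
    refine ⟨_, G.edgeSet, ⟨subset_rfl, fun t₁ _ t₂ _ hlab => ?_⟩, rfl⟩
    rw [G.deleteEdges_edgeSet, sdiff_self]
    rintro h
    rw [SimpleGraph.reachable_bot] at h
    exact hlab (congrArg lab h)
  obtain ⟨F, ⟨hFG, hF⟩, hcard⟩ := Nat.sInf_mem hne
  let φ : V → ℕ := fun v =>
    if h : ∃ t ∈ S, (G.deleteEdges F).Reachable v t then lab h.choose else 0
  have hφ : ∀ v t, t ∈ S → (G.deleteEdges F).Reachable v t → φ v = lab t := by
    intro v t ht hvt
    have h : ∃ t ∈ S, (G.deleteEdges F).Reachable v t := ⟨t, ht, hvt⟩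
    simp only [φ, dif_pos h]
    by_contra hcon
    exact hF _ h.choose_spec.1 t ht hcon (h.choose_spec.2.symm.trans hvt)
  refine ⟨φ, fun t ht => hφ t t ht (SimpleGraph.Reachable.refl t), ?_⟩
  refine le_of_le_of_eq (Set.ncard_le_ncard ?_ (Set.toFinite F)) hcard
  rintro _ ⟨u, v, huv, hne, rfl⟩
  by_contra hcon
  have hadj : (G.deleteEdges F).Adj u v := by
    rw [SimpleGraph.deleteEdges_adj]
    exact ⟨huv, hcon⟩
  apply hne
  by_cases h : ∃ t ∈ S, (G.deleteEdges F).Reachable v t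
  · obtain ⟨t, ht, hvt⟩ := h
    rw [hφ v t ht hvt, hφ u t ht (hadj.reachable.trans hvt)]
  · have hu : ¬ ∃ t ∈ S, (G.deleteEdges F).Reachable u t := fun ⟨t, ht, hut⟩ =>
      h ⟨t, ht, hadj.symm.reachable.trans hut⟩
    simp only [φ, dif_neg h, dif_neg hu]

/-- The graph obtained from the multigraph with ends `a` and `b` by subdividing every edge. -/
def subdivision {U E : Type} (a b : E → U) : SimpleGraph (U ⊕ E) :=
  SimpleGraph.fromRel fun x y => ∃ e, y = Sum.inr e ∧ (x = Sum.inl (a e) ∨ x = Sum.inl (b e))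

theorem mem_edgeSet_subdivision {U E : Type} {a b : E → U} {d : Sym2 (U ⊕ E)}
    (hd : d ∈ (subdivision a b).edgeSet) :
    ∃ e, d = s(Sum.inl (a e), Sum.inr e) ∨ d = s(Sum.inl (b e), Sum.inr e) := by
  induction d using Sym2.ind with
  | _ x y =>
    rw [SimpleGraph.mem_edgeSet, subdivision, SimpleGraph.fromRel_adj] at hd
    rcases hd with ⟨_, ⟨e, rfl, rfl | rfl⟩ | ⟨e, rfl, rfl | rfl⟩⟩
    exacts [⟨e, Or.inl rfl⟩, ⟨e, Or.inr rfl⟩, ⟨e, Or.inl Sym2.eq_swap⟩, ⟨e, Or.inr Sym2.eq_swap⟩]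

theorem ncard_edgeSet_subdivision_le {U E : Type} [Fintype E] (a b : E → U) :
    (subdivision a b).edgeSet.ncard ≤ 2 * Fintype.card E := by
  let D : Finset (Sym2 (U ⊕ E)) := Finset.univ.image (fun e => s(Sum.inl (a e), Sum.inr e)) ∪
    Finset.univ.image (fun e => s(Sum.inl (b e), Sum.inr e))
  have h1 : (subdivision a b).edgeSet ⊆ D := by
    intro d hd
    obtain ⟨e, rfl | rfl⟩ := mem_edgeSet_subdivision hd <;> simp [D]
  have h2 := Set.ncard_le_ncard h1 D.finite_toSet
  rw [Set.ncard_coe_finset] at h2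
  refine h2.trans ((Finset.card_union_le _ _).trans ?_)
  rw [two_mul]
  exact Nat.add_le_add Finset.card_image_le Finset.card_image_le

theorem ncard_bichromaticEdges_subdivision_le {U E : Type} [Fintype E] (a b : E → U)
    (χ : U → ℕ) :
    (bichromaticEdges (subdivision a b) (Sum.elim χ fun e => χ (a e))).ncard ≤ cutCost a b χ := by
  let D : Finset (Sym2 (U ⊕ E)) :=
    ({e | χ (a e) ≠ χ (b e)} : Finset E).image (fun e => s(Sum.inl (b e), Sum.inr e))
  have h1 : bichromaticEdges (subdivision a b) (Sum.elim χ fun e => χ (a e)) ⊆ D := by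
    rintro _ ⟨x, y, hadj, hne, rfl⟩
    rw [subdivision, SimpleGraph.fromRel_adj] at hadj
    simp only [D, Finset.coe_image, Finset.coe_filter, Finset.mem_univ, true_and, Set.mem_image]
    rcases hadj with ⟨_, ⟨e, rfl, rfl | rfl⟩ | ⟨e, rfl, rfl | rfl⟩⟩
    · simp at hne
    · exact ⟨e, Ne.symm hne, rfl⟩
    · simp at hne
    · exact ⟨e, hne, Sym2.eq_swap⟩
  have h2 := Set.ncard_le_ncard h1 D.finite_toSet
  rw [Set.ncard_coe_finset] at h2
  exact h2.trans Finset.card_image_le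

theorem cutCost_le_ncard_bichromaticEdges_subdivision {U E : Type} [Finite U] [Fintype E]
    (a b : E → U) (ψ : U ⊕ E → ℕ) :
    cutCost a b (fun u => ψ (Sum.inl u)) ≤ (bichromaticEdges (subdivision a b) ψ).ncard := by
  let d : E → Sym2 (U ⊕ E) := fun e =>
    s(Sum.inl (if ψ (Sum.inl (a e)) ≠ ψ (Sum.inr e) then a e else b e), Sum.inr e)
  have hd : Function.Injective d := by
    intro e g h
    simp only [d, Sym2.eq_iff, Sum.inr.injEq, reduceCtorEq, false_and, or_false] at h
    exact h.2
  rw [cutCost, ← Finset.card_image_of_injective _ hd, ← Set.ncard_coe_finset]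
  refine Set.ncard_le_ncard ?_ (Set.toFinite _)
  intro x hx
  simp only [Finset.coe_image, Finset.coe_filter, Finset.mem_univ, true_and, Set.mem_image] at hx
  obtain ⟨e, he, rfl⟩ := hx
  refine ⟨_, _, ?_, ?_, rfl⟩
  · rw [subdivision, SimpleGraph.fromRel_adj]
    refine ⟨by simp, Or.inl ⟨e, rfl, ?_⟩⟩
    split_ifs <;> simp
  · split_ifs with h
    · exact h
    · rw [not_not] at h
      rw [← h]
      exact Ne.symm he

/-- An end of the edge `e` of `G`. -/
noncomputable def edgeFst {V : Type} (G : SimpleGraph V) (e : G.edgeSet) : V := (Quot.out e.1).1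

/-- The end of the edge `e` of `G` other than `edgeFst G e`. -/
noncomputable def edgeSnd {V : Type} (G : SimpleGraph V) (e : G.edgeSet) : V := (Quot.out e.1).2

theorem mk_edgeFst_edgeSnd {V : Type} (G : SimpleGraph V) (e : G.edgeSet) :
    s(edgeFst G e, edgeSnd G e) = e.1 :=
  Quot.out_eq e.1

theorem cutCost_edgeFst_edgeSnd {V : Type} (G : SimpleGraph V) [Fintype G.edgeSet] (φ : V → ℕ) :
    cutCost (edgeFst G) (edgeSnd G) φ = (bichromaticEdges G φ).ncard := by
  rw [cutCost, ← Finset.card_image_of_injective _ Subtype.val_injective, ← Set.ncard_coe_finset]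
  congr 1
  ext d
  simp only [Finset.coe_image, Finset.coe_filter, Finset.mem_univ, true_and, Set.mem_image]
  constructor
  · rintro ⟨e, he, rfl⟩
    refine ⟨_, _, ?_, he, mk_edgeFst_edgeSnd G e⟩
    rw [← SimpleGraph.mem_edgeSet, mk_edgeFst_edgeSnd]
    exact e.2
  · rintro ⟨u, v, huv, hne, rfl⟩
    refine ⟨⟨s(u, v), huv⟩, ?_, rfl⟩
    rcases Sym2.eq_iff.mp (mk_edgeFst_edgeSnd G ⟨s(u, v), huv⟩) with ⟨h1, h2⟩ | ⟨h1, h2⟩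
    · simpa [h1, h2] using hne
    · simpa [h1, h2] using hne.symm

theorem terminalCapacity_le_sum_degree {V : Type} [Fintype V] (G : SimpleGraph V)
    [Fintype G.edgeSet] (T : Finset V) :
    terminalCapacity (edgeFst G) (edgeSnd G) (T : Set V) ≤ ∑ t ∈ T, G.degree t := by
  calc terminalCapacity (edgeFst G) (edgeSnd G) (T : Set V)
      = ∑ e, ∑ t ∈ T, ((if edgeFst G e = t then 1 else 0) +
          (if edgeSnd G e = t then 1 else 0)) := by
        refine Finset.sum_congr rfl fun e _ => ?_
        rw [Finset.sum_add_distrib, Finset.sum_ite_eq, Finset.sum_ite_eq]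
        simp
    _ = ∑ t ∈ T, ∑ e, ((if edgeFst G e = t then 1 else 0) +
          (if edgeSnd G e = t then 1 else 0)) := Finset.sum_comm
    _ ≤ ∑ t ∈ T, G.degree t := by
        refine Finset.sum_le_sum fun t _ => ?_
        rw [← SimpleGraph.card_incidenceFinset_eq_degree]
        have h1 : ∀ e : G.edgeSet, (if edgeFst G e = t then 1 else 0) +
            (if edgeSnd G e = t then 1 else 0) = if t ∈ e.1 then 1 else 0 := by
          intro e
          have hadj : G.Adj (edgeFst G e) (edgeSnd G e) := by
            rw [← SimpleGraph.mem_edgeSet, mk_edgeFst_edgeSnd]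
            exact e.2
          have hmem : t ∈ e.1 ↔ t = edgeFst G e ∨ t = edgeSnd G e :=
            (iff_of_eq (congrArg (t ∈ ·) (mk_edgeFst_edgeSnd G e).symm)).trans Sym2.mem_iff
          simp only [hmem]
          have := hadj.ne
          split_ifs <;> first | rfl | (exfalso; grind)
        rw [Finset.sum_congr rfl fun e _ => h1 e, ← Finset.card_filter,
          ← Finset.card_image_of_injective _ Subtype.val_injective]
        refine Finset.card_le_card fun d hd => ?_
        simp only [Finset.mem_image, Finset.mem_filter, Finset.mem_univ, true_and] at hd
        obtain ⟨e, he, rfl⟩ := hd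
        rw [SimpleGraph.mem_incidenceFinset]
        exact ⟨e.2, he⟩

theorem card_le_sum_degree {V : Type} [Fintype V] {G : SimpleGraph V} (hG : G.Connected)
    (T : Finset V) (hT : 0 < ∑ t ∈ T, G.degree t) : #T ≤ ∑ t ∈ T, G.degree t := by
  have hnt : Nontrivial V := by
    obtain ⟨t, _, ht⟩ := Finset.exists_ne_zero_of_sum_ne_zero hT.ne'
    obtain ⟨v, hv⟩ := (G.degree_pos_iff_exists_adj t).mp (Nat.pos_of_ne_zero ht)
    exact ⟨t, v, hv.ne⟩
  rw [Finset.card_eq_sum_ones]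
  exact Finset.sum_le_sum fun t _ => hG.preconnected.degree_pos_of_nontrivial t

theorem size_le_rpow {k : ℕ} (hk : 2 ≤ k) :
    ((k + 5 * (k * (6 * k ^ 5) ^ (Nat.log 2 k + 1)) : ℕ) : ℝ) ≤
      (k : ℝ) ^ ((100 : ℝ) * Real.log k ^ 2) := by
  have h8 : 2 ^ 3 ≤ k ^ 3 := Nat.pow_le_pow_left hk 3
  have h1 : 6 * k ^ 5 ≤ k ^ 8 := by
    calc 6 * k ^ 5 ≤ k ^ 3 * k ^ 5 := Nat.mul_le_mul_right _ (by omega)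
      _ = k ^ 8 := by ring
  have h2 : k * (6 * k ^ 5) ^ (Nat.log 2 k + 1) ≤ k ^ (8 * Nat.log 2 k + 9) := by
    calc k * (6 * k ^ 5) ^ (Nat.log 2 k + 1) ≤ k * (k ^ 8) ^ (Nat.log 2 k + 1) := by gcongr
      _ = k ^ (8 * Nat.log 2 k + 9) := by rw [← pow_mul]; ring
  have h3 : k ≤ k ^ (8 * Nat.log 2 k + 9) := Nat.le_self_pow (by omega) k
  have h4 : k + 5 * (k * (6 * k ^ 5) ^ (Nat.log 2 k + 1)) ≤ k ^ (8 * Nat.log 2 k + 12) := by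
    calc k + 5 * (k * (6 * k ^ 5) ^ (Nat.log 2 k + 1))
        ≤ k ^ 3 * k ^ (8 * Nat.log 2 k + 9) := by nlinarith
      _ = k ^ (8 * Nat.log 2 k + 12) := by ring
  have hk1 : (1 : ℝ) ≤ k := by exact_mod_cast (by omega : 1 ≤ k)
  calc ((k + 5 * (k * (6 * k ^ 5) ^ (Nat.log 2 k + 1)) : ℕ) : ℝ)
      ≤ ((k ^ (8 * Nat.log 2 k + 12) : ℕ) : ℝ) := by exact_mod_cast h4
    _ = (k : ℝ) ^ ((8 * Nat.log 2 k + 12 : ℕ) : ℝ) := by rw [Real.rpow_natCast]; push_cast; rfl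
    _ ≤ _ := by
      apply Real.rpow_le_rpow_of_exponent_le hk1
      have hl2 := Real.log_two_gt_d9
      have hlog : (Nat.log 2 k : ℝ) * Real.log 2 ≤ Real.log k := by
        rw [← Real.log_pow]
        apply Real.log_le_log (by positivity)
        exact_mod_cast Nat.pow_log_le_self 2 (by omega)
      have hlk : Real.log 2 ≤ Real.log k :=
        Real.log_le_log (by norm_num) (by exact_mod_cast hk)
      have hL : (0 : ℝ) ≤ Nat.log 2 k := Nat.cast_nonneg _
      push_cast
      nlinarith

/-- Existence of quasipolynomial-size multicut mimicking networks. -/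
theorem multicut_mimicking_network :
    ∃ c : ℝ, 1 ≤ c ∧
      ∀ (V : Type) [Fintype V] (G : SimpleGraph V) (T : Finset V) (k : ℕ),
        G.Connected → (∑ t ∈ T, G.degree t) = k → 2 ≤ k →
        ∃ (V' : Type) (inst : Fintype V') (G' : SimpleGraph V') (f : V → V'),
          Set.InjOn f (T : Set V) ∧
          (((@Fintype.card V' inst + G'.edgeSet.ncard : ℕ)) : ℝ) ≤
            (k : ℝ) ^ (c * (Real.log (k : ℝ)) ^ 2) ∧
          ∀ (lab : V → ℕ) (lab' : V' → ℕ), (∀ t ∈ T, lab' (f t) = lab t) →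
            minMultiwayCut G (T : Set V) lab =
              minMultiwayCut G' (f '' (T : Set V)) lab' := by
  refine ⟨100, by norm_num, fun V _ G T k hG hk hk2 => ?_⟩
  have hTk : #T ≤ k := (card_le_sum_degree hG T (by omega)).trans hk.le
  have hcap := (terminalCapacity_le_sum_degree G T).trans hk.le
  obtain ⟨t₀, ht₀⟩ : T.Nonempty := by
    rw [Finset.nonempty_iff_ne_empty]
    rintro rfl
    simp at hk
    omega
  obtain ⟨π, hπ, hforced⟩ := exists_minimal_contraction (edgeFst G) (edgeSnd G) (T : Set V)
  let E' := {e // π (edgeFst G e) ≠ π (edgeSnd G e)}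
  let a' : E' → V := fun e => π (edgeFst G e)
  let b' : E' → V := fun e => π (edgeSnd G e)
  have hcap' : terminalCapacity a' b' (T : Set V) ≤ k := (hπ.terminalCapacity_le _).trans hcap
  have hE' : Fintype.card E' ≤ k * (6 * k ^ 5) ^ (Nat.log 2 k + 1) := by
    refine (card_edges_le_of_forcesCut _ E' a' b' T rfl hforced).trans ?_
    gcongr
    · nlinarith [pow_pos (show 0 < k by omega) 5]
  let used : Finset V := T ∪ (Finset.univ.image a' ∪ Finset.univ.image b')
  let aU : E' → used := fun e => ⟨a' e, by simp [used]⟩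
  let bU : E' → used := fun e => ⟨b' e, by simp [used]⟩
  have hTused : ∀ t ∈ T, t ∈ used := fun t ht => Finset.mem_union_left _ ht
  let f : V → used ⊕ E' := fun v =>
    Sum.inl (if h : v ∈ used then ⟨v, h⟩ else ⟨t₀, hTused t₀ ht₀⟩)
  have hf : ∀ t (ht : t ∈ T), f t = Sum.inl ⟨t, hTused t ht⟩ := fun t ht => by
    simp only [f, dif_pos (hTused t ht)]
  have hcost : ∀ χ : V → ℕ, cutCost a' b' χ = cutCost (fun e => π (edgeFst G e))
      (fun e => π (edgeSnd G e)) χ := fun χ => cutCost_subtype_ne _ _ χ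
  refine ⟨used ⊕ E', inferInstance, subdivision aU bU, f, ?_, ?_, fun lab lab' hlab => ?_⟩
  · intro t ht t' ht' h
    rw [hf t ht, hf t' ht'] at h
    simpa using h
  · refine le_trans ?_ (size_le_rpow hk2)
    rw [Nat.cast_le, Fintype.card_sum, Fintype.card_coe]
    have h1 := ncard_edgeSet_subdivision_le aU bU
    have h2 : #used ≤ k + (Fintype.card E' + Fintype.card E') :=
      (Finset.card_union_le _ _).trans (Nat.add_le_add hTk ((Finset.card_union_le _ _).trans
        (Nat.add_le_add Finset.card_image_le Finset.card_image_le)))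
    omega
  · apply le_antisymm
    · obtain ⟨ψ, hψ, hψc⟩ := exists_ncard_bichromaticEdges_le (subdivision aU bU)
        (f '' (T : Set V)) lab'
      let χ : V → ℕ := fun v => if h : v ∈ used then ψ (Sum.inl ⟨v, h⟩) else 0
      have hχ : (fun v : used => χ v) = fun u => ψ (Sum.inl u) := by
        funext u
        simp [χ]
      refine le_trans ?_ hψc
      refine le_trans ?_ (cutCost_le_ncard_bichromaticEdges_subdivision aU bU ψ)
      rw [← hχ]
      change _ ≤ cutCost a' b' χ
      rw [hcost]
      change _ ≤ cutCost (edgeFst G) (edgeSnd G) (χ ∘ π)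
      rw [cutCost_edgeFst_edgeSnd]
      apply minMultiwayCut_le_ncard_bichromaticEdges
      intro t ht
      rw [Function.comp_apply, hπ.1 t ht, ← hlab t ht, ← hψ ⟨t, ht, rfl⟩, hf t ht]
      simp only [χ, dif_pos (hTused t ht)]
    · obtain ⟨φ, hφ, hφc⟩ := exists_ncard_bichromaticEdges_le G (T : Set V) lab
      obtain ⟨χ, hχ, hχc⟩ := hπ.2.2 φ
      rw [← hcost, cutCost_edgeFst_edgeSnd] at hχc
      refine le_trans ?_ (hχc.trans hφc)
      refine le_trans ?_ (ncard_bichromaticEdges_subdivision_le aU bU fun u => χ u)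
      apply minMultiwayCut_le_ncard_bichromaticEdges
      rintro _ ⟨t, ht, rfl⟩
      rw [hlab t ht, hf t ht, ← hφ ht, ← hχ ht]
      rfl
end
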